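/- arXiv:1906.00652 — 3 statements merged into one kernel-verified Lean document; each statement's English description precedes it below -/
import Mathlib

section
/- Let J(K_n) be the cover ideal of the complete graph on n vertices. Then the projective dimension of S/J(K_n)^s is s+1 if s < n−1, and n if s ≥ n−1. -/
open MvPolynomial

/-- `b : ℕ → ℕ` is the sequence of ranks of a minimal free resolution of the
module `M` over the polynomial ring `S = k[X_1,…,X_n]`; by minimality the `b i`
are the total Betti numbers `β_i(M) = dim_k Tor_i^S(M,k)`. -/
def IsMinimalFreeResolution (k : Type*) [Field k] (n : ℕ) (b : ℕ → ℕ)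
    (M : Type*) [AddCommGroup M] [Module (MvPolynomial (Fin n) k) M] : Prop :=
  ∃ (d : (i : ℕ) → (Fin (b (i + 1)) →₀ MvPolynomial (Fin n) k) →ₗ[MvPolynomial (Fin n) k]
        (Fin (b i) →₀ MvPolynomial (Fin n) k))
    (ε : (Fin (b 0) →₀ MvPolynomial (Fin n) k) →ₗ[MvPolynomial (Fin n) k] M),
    Function.Surjective ε ∧
    LinearMap.ker ε = LinearMap.range (d 0) ∧
    (∀ i, LinearMap.ker (d i) = LinearMap.range (d (i + 1))) ∧
    (∀ i p q, constantCoeff (d i (Finsupp.single p 1) q) = 0)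

section ExtLemmas

open CategoryTheory Abelian

universe u

variable {R : Type u} [CommRing R]

/-- The group `Ext^i_R(M, Y)` of unbundled modules. -/
abbrev ModuleExt (R : Type u) [CommRing R] (M Y : Type u) [AddCommGroup M] [Module R M]
    [AddCommGroup Y] [Module R Y] (i : ℕ) : Type u :=
  Ext (ModuleCat.of R M) (ModuleCat.of R Y) i

variable {M₁ M₂ M₃ Y : Type u} [AddCommGroup M₁] [Module R M₁] [AddCommGroup M₂] [Module R M₂]
  [AddCommGroup M₃] [Module R M₃] [AddCommGroup Y] [Module R Y]

lemma exists_shortExact {f : M₁ →ₗ[R] M₂} {g : M₂ →ₗ[R] M₃} (hf : Function.Injective f)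
    (hfg : Function.Exact f g) (hg : Function.Surjective g) :
    ∃ w, (ShortComplex.mk (ModuleCat.ofHom f) (ModuleCat.ofHom g) w).ShortExact :=
  ⟨by ext x; exact hfg.apply_apply_eq_zero x, ModuleCat.shortComplex_shortExact _ hfg hf hg⟩

lemma moduleExt_subsingleton_middle {f : M₁ →ₗ[R] M₂} {g : M₂ →ₗ[R] M₃}
    (hf : Function.Injective f) (hfg : Function.Exact f g) (hg : Function.Surjective g) {i : ℕ}
    (h₁ : Subsingleton (ModuleExt R M₁ Y i)) (h₃ : Subsingleton (ModuleExt R M₃ Y i)) :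
    Subsingleton (ModuleExt R M₂ Y i) := by
  obtain ⟨w, hS⟩ := exists_shortExact hf hfg hg
  refine subsingleton_of_forall_eq 0 fun x => ?_
  obtain ⟨y, rfl⟩ := Ext.contravariant_sequence_exact₂ hS _ x (h₁.elim _ _)
  rw [h₃.elim y 0, Ext.comp_zero]

lemma moduleExt_subsingleton_right {f : M₁ →ₗ[R] M₂} {g : M₂ →ₗ[R] M₃}
    (hf : Function.Injective f) (hfg : Function.Exact f g) (hg : Function.Surjective g) {i : ℕ}
    (h₁ : Subsingleton (ModuleExt R M₁ Y i)) (h₂ : Subsingleton (ModuleExt R M₂ Y (i + 1))) :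
    Subsingleton (ModuleExt R M₃ Y (i + 1)) := by
  obtain ⟨w, hS⟩ := exists_shortExact hf hfg hg
  refine subsingleton_of_forall_eq 0 fun x => ?_
  obtain ⟨y, rfl⟩ := Ext.contravariant_sequence_exact₃ hS _ x (h₂.elim _ _) (add_comm 1 i)
  rw [h₁.elim y 0, Ext.comp_zero]

lemma moduleExt_subsingleton_left {f : M₁ →ₗ[R] M₂} {g : M₂ →ₗ[R] M₃}
    (hf : Function.Injective f) (hfg : Function.Exact f g) (hg : Function.Surjective g) {i : ℕ}
    (hzero : ∀ x : ModuleExt R M₂ Y i,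
      (Ext.mk₀ (ModuleCat.ofHom f)).comp x (zero_add i) = 0)
    (h₃ : Subsingleton (ModuleExt R M₃ Y (i + 1))) :
    Subsingleton (ModuleExt R M₁ Y i) := by
  obtain ⟨w, hS⟩ := exists_shortExact hf hfg hg
  refine subsingleton_of_forall_eq 0 fun x => ?_
  obtain ⟨y, rfl⟩ := Ext.contravariant_sequence_exact₁ hS _ x (add_comm 1 i) (h₃.elim _ _)
  exact hzero y

lemma moduleExt_smul_eq_zero {r : R} (hr : ∀ y : Y, r • y = 0) {i : ℕ}
    (x : ModuleExt R M₁ Y i) : r • x = 0 := by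
  have : r • 𝟙 (ModuleCat.of R Y) = 0 := by ext y; exact hr y
  rw [Ext.smul_eq_comp_mk₀, this, Ext.mk₀_zero, Ext.comp_zero]

lemma moduleExt_zero_subsingleton_iff :
    Subsingleton (ModuleExt R M₁ Y 0) ↔ Subsingleton (M₁ →ₗ[R] Y) :=
  (Ext.homEquiv₀.trans ModuleCat.homEquiv).subsingleton_congr

lemma moduleExt_subsingleton_of_projective [Module.Projective R M₁] (i : ℕ) :
    Subsingleton (ModuleExt R M₁ Y (i + 1)) :=
  haveI := (IsProjective.iff_projective M₁).mp ‹_›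
  Ext.subsingleton_of_projective _ _ i

/-- Dimension shifting along a minimal projective cover, including the bottom degree. -/
lemma moduleExt_subsingleton_succ_iff {f : M₁ →ₗ[R] M₂} {g : M₂ →ₗ[R] M₃}
    (hf : Function.Injective f) (hfg : Function.Exact f g) (hg : Function.Surjective g)
    [Module.Projective R M₂] (hmin : ∀ φ : M₂ →ₗ[R] Y, φ ∘ₗ f = 0) (i : ℕ) :
    Subsingleton (ModuleExt R M₃ Y (i + 1)) ↔ Subsingleton (ModuleExt R M₁ Y i) := by
  refine ⟨moduleExt_subsingleton_left hf hfg hg fun x => ?_, fun h =>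
    moduleExt_subsingleton_right hf hfg hg h (moduleExt_subsingleton_of_projective i)⟩
  cases i with
  | zero =>
    obtain ⟨φ, rfl⟩ := (Ext.mk₀_bijective _ _).surjective x
    rw [Ext.mk₀_comp_mk₀, Ext.mk₀_eq_zero_iff]
    ext y
    exact LinearMap.congr_fun (hmin φ.hom) y
  | succ i =>
    rw [(moduleExt_subsingleton_of_projective i).elim x 0, Ext.comp_zero]

lemma moduleExt_zero_subsingleton_iff_of_surjective {g : M₂ →ₗ[R] M₃}
    (hg : Function.Surjective g) (hker : ∀ φ : M₂ →ₗ[R] Y, LinearMap.ker g ≤ LinearMap.ker φ) :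
    Subsingleton (ModuleExt R M₃ Y 0) ↔ Subsingleton (ModuleExt R M₂ Y 0) := by
  rw [moduleExt_zero_subsingleton_iff, moduleExt_zero_subsingleton_iff]
  constructor
  · refine fun h => subsingleton_of_forall_eq 0 fun φ => ?_
    ext x
    simpa using LinearMap.congr_fun (h.elim (((LinearMap.ker g).liftQ φ (hker φ)) ∘ₗ
      (g.quotKerEquivOfSurjective hg).symm.toLinearMap) 0) (g x)
  · refine fun h => subsingleton_of_forall_eq 0 fun ψ => ?_
    ext y
    obtain ⟨x, rfl⟩ := hg y
    exact LinearMap.congr_fun (h.elim (ψ ∘ₗ g) 0) x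

lemma moduleExt_zero_finsupp_subsingleton_iff [Nontrivial Y] (m : ℕ) :
    Subsingleton (ModuleExt R (Fin m →₀ R) Y 0) ↔ m = 0 := by
  rw [moduleExt_zero_subsingleton_iff, ← (Finsupp.lift Y R (Fin m)).toEquiv.subsingleton_congr]
  constructor
  · intro h
    by_contra hm
    have : Nonempty (Fin m) := ⟨⟨0, Nat.pos_of_ne_zero hm⟩⟩
    exact not_subsingleton (Fin m → Y) h
  · rintro rfl
    infer_instance

lemma moduleExt_top_subsingleton_iff [Nontrivial Y] {I : Ideal R} (hI : I = ⊤) (i : ℕ) :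
    Subsingleton (ModuleExt R I Y i) ↔ 0 < i := by
  subst hI
  cases i with
  | zero =>
    rw [moduleExt_zero_subsingleton_iff]
    refine iff_of_false (fun h => ?_) (lt_irrefl 0)
    obtain ⟨y, hy⟩ := exists_ne (0 : Y)
    have := LinearMap.congr_fun (h.elim (LinearMap.toSpanSingleton R Y y ∘ₗ
      (⊤ : Ideal R).subtype) 0) ⟨1, trivial⟩
    exact hy (by simpa using this)
  | succ i =>
    have : Module.Projective R (⊤ : Ideal R) :=
      Module.Projective.of_equiv Submodule.topEquiv.symm
    exact iff_of_true (moduleExt_subsingleton_of_projective i) i.succ_pos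

end ExtLemmas

section Monomial

variable {σ k : Type*} [Field k]

/-- The residue field of `MvPolynomial σ k` at the origin. -/
abbrev OriginResidue (σ k : Type*) [Field k] : Type _ :=
  MvPolynomial σ k ⧸ RingHom.ker (constantCoeff : MvPolynomial σ k →+* k)

instance : Nontrivial (OriginResidue σ k) :=
  Ideal.Quotient.nontrivial_iff.mpr (RingHom.ker_ne_top _)

lemma smul_originResidue_eq_zero {p : MvPolynomial σ k} (hp : constantCoeff p = 0)
    (y : OriginResidue σ k) : p • y = 0 := by
  obtain ⟨q, rfl⟩ := Ideal.Quotient.mk_surjective y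
  rw [← Ideal.Quotient.mk_eq_mk, ← Submodule.Quotient.mk_smul, Ideal.Quotient.mk_eq_mk,
    Ideal.Quotient.eq_zero_iff_mem, smul_eq_mul]
  exact Ideal.mul_mem_right _ _ hp

/-- The `s`-th power of the cover ideal of the complete graph on `t`, described by the exponents
of its monomials. -/
def coverPower (k : Type*) [Field k] {σ : Type*} (t : Finset σ) (s : ℕ) :
    Ideal (MvPolynomial σ k) where
  carrier := {f | ∀ a ∈ f.support, ∑ i ∈ t, (s - a i) ≤ s}
  zero_mem' := by simp
  add_mem' {f g} hf hg a ha := by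
    classical
    rcases Finset.mem_union.mp (support_add ha) with h | h
    exacts [hf a h, hg a h]
  smul_mem' c f hf a ha := by
    classical
    obtain ⟨b, -, c, hc, rfl⟩ := Finset.mem_add.mp (support_mul _ _ ha)
    refine le_trans (Finset.sum_le_sum fun i _ => ?_) (hf c hc)
    simp only [Finsupp.add_apply]
    lia

lemma monomial_mem_coverPower {t : Finset σ} {s : ℕ} {a : σ →₀ ℕ} {c : k}
    (h : ∑ i ∈ t, (s - a i) ≤ s) : monomial a c ∈ coverPower k t s := by
  intro b hb
  rwa [Finset.mem_singleton.mp (support_monomial_subset hb)]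

lemma monomial_mul_mem_coverPower {t t' : Finset σ} {s s' : ℕ} {m : σ →₀ ℕ}
    (h : ∀ a : σ →₀ ℕ, ∑ i ∈ t, (s - a i) ≤ s → ∑ i ∈ t', (s' - (m i + a i)) ≤ s')
    {f : MvPolynomial σ k} (hf : f ∈ coverPower k t s) :
    monomial m 1 * f ∈ coverPower k t' s' := by
  classical
  intro b hb
  obtain ⟨c, hc, a, ha, rfl⟩ := Finset.mem_add.mp (support_mul _ _ hb)
  rw [Finset.mem_singleton.mp (support_monomial_subset hc)]
  exact h a (hf a ha)

/-- Multiplication by a monomial as a linear map between the ideals `coverPower`. -/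
noncomputable def coverPowerMul (k : Type*) [Field k] {t t' : Finset σ} {s s' : ℕ} (m : σ →₀ ℕ)
    (h : ∀ a : σ →₀ ℕ, ∑ i ∈ t, (s - a i) ≤ s → ∑ i ∈ t', (s' - (m i + a i)) ≤ s') :
    coverPower k t s →ₗ[MvPolynomial σ k] coverPower k t' s' :=
  (LinearMap.mulLeft (MvPolynomial σ k) (monomial m 1)).restrict
    fun _ hf => monomial_mul_mem_coverPower h hf

@[simp]
lemma coe_coverPowerMul {t t' : Finset σ} {s s' : ℕ} (m : σ →₀ ℕ)
    (h : ∀ a : σ →₀ ℕ, ∑ i ∈ t, (s - a i) ≤ s → ∑ i ∈ t', (s' - (m i + a i)) ≤ s')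
    (f : coverPower k t s) :
    (coverPowerMul k m h f : MvPolynomial σ k) = monomial m 1 * (f : MvPolynomial σ k) := rfl

/-- The exponent vector of the squarefree monomial with support `t`. -/
noncomputable def sqfreeExp (t : Finset σ) : σ →₀ ℕ := Finsupp.indicator t fun _ _ => 1

lemma sqfreeExp_apply_of_mem {t : Finset σ} {i : σ} (hi : i ∈ t) : sqfreeExp t i = 1 :=
  Finsupp.indicator_of_mem hi _

lemma sqfreeExp_apply_of_notMem {t : Finset σ} {i : σ} (hi : i ∉ t) : sqfreeExp t i = 0 :=
  Finsupp.indicator_of_notMem hi _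

section Pascal

variable {t : Finset σ} {l : σ} (hl : l ∉ t) (s : ℕ)

include hl in
lemma sum_sub_single_add {r r' : ℕ} (a : σ →₀ ℕ) :
    ∑ i ∈ t, (r' - (Finsupp.single l r i + a i)) = ∑ i ∈ t, (r' - a i) := by
  refine Finset.sum_congr rfl fun i hi => ?_
  rw [Finsupp.single_eq_of_ne (by rintro rfl; exact hl hi), zero_add]

lemma sum_succ_sub_sqfreeExp_add (a : σ →₀ ℕ) :
    ∑ i ∈ t, (s + 1 - (sqfreeExp t i + a i)) = ∑ i ∈ t, (s - a i) := by
  refine Finset.sum_congr rfl fun i hi => ?_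
  rw [sqfreeExp_apply_of_mem hi]
  lia

lemma cons_sum_sub_single_add {r : ℕ} (hr : s ≤ r) (a : σ →₀ ℕ) :
    ∑ i ∈ t.cons l hl, (s - (Finsupp.single l r i + a i)) = ∑ i ∈ t, (s - a i) := by
  rw [Finset.sum_cons, sum_sub_single_add hl, Finsupp.single_eq_same]
  lia

lemma cons_sum_succ_sub_sqfreeExp_add_le (a : σ →₀ ℕ)
    (ha : ∑ i ∈ t.cons l hl, (s - a i) ≤ s) :
    ∑ i ∈ t.cons l hl, (s + 1 - (sqfreeExp t i + a i)) ≤ s + 1 := by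
  rw [Finset.sum_cons] at ha ⊢
  rw [sum_succ_sub_sqfreeExp_add, sqfreeExp_apply_of_notMem hl]
  lia

lemma sum_succ_sub_sqfreeExp_erase_add_le [DecidableEq σ] {j : σ} (hj : j ∈ t) (a : σ →₀ ℕ)
    (ha : ∑ i ∈ t, (s - a i) ≤ s) :
    ∑ i ∈ t, (s + 1 - (sqfreeExp (t.erase j) i + a i)) ≤ s + 1 := by
  rw [← Finset.sum_erase_add _ _ hj] at ha ⊢
  rw [sum_succ_sub_sqfreeExp_add, sqfreeExp_apply_of_notMem (t.notMem_erase j)]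
  lia

variable (k)

/-- The inclusion of the syzygies in `coverPower_exact`. -/
noncomputable def coverPowerSyz : coverPower k t s →ₗ[MvPolynomial σ k]
    coverPower k (t.cons l hl) s × coverPower k t (s + 1) :=
  (coverPowerMul k (Finsupp.single l (s + 1)) fun a ha => by
    rwa [cons_sum_sub_single_add hl s s.le_succ]).prod
  (-coverPowerMul k (sqfreeExp t) fun a ha => by rw [sum_succ_sub_sqfreeExp_add]; lia)

/-- The decomposition of `coverPower k (t.cons l hl) (s + 1)` into multiples of the squarefree
monomial supported on `t` and of `X l ^ (s + 1)`. -/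
noncomputable def coverPowerSum : coverPower k (t.cons l hl) s × coverPower k t (s + 1)
    →ₗ[MvPolynomial σ k] coverPower k (t.cons l hl) (s + 1) :=
  (coverPowerMul k (sqfreeExp t) (cons_sum_succ_sub_sqfreeExp_add_le hl s)).coprod
  (coverPowerMul k (Finsupp.single l (s + 1)) fun a ha => by
    rwa [cons_sum_sub_single_add hl (s + 1) le_rfl])

lemma coverPowerSyz_injective : Function.Injective (coverPowerSyz k hl s) := by
  intro x y h
  have := congrArg Subtype.val (Prod.ext_iff.mp h).1
  exact Subtype.ext (mul_left_cancel₀ (by simp) this)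

lemma coverPower_exact : Function.Exact (coverPowerSyz k hl s) (coverPowerSum k hl s) := by
  rintro ⟨y, z⟩
  constructor
  · intro h
    have h0 : monomial (sqfreeExp t) 1 * (y : MvPolynomial σ k) +
        monomial (Finsupp.single l (s + 1)) 1 * (z : MvPolynomial σ k) = 0 :=
      congrArg Subtype.val h
    have hdvd : X l ^ (s + 1) ∣ (y : MvPolynomial σ k) := by
      refine (X_prime (i := l)).pow_dvd_of_dvd_mul_left (s + 1) (a := monomial (sqfreeExp t) 1) ?_ ?_
      · simp [X_dvd_monomial, sqfreeExp_apply_of_notMem hl]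
      · rw [X_pow_eq_monomial, eq_neg_of_add_eq_zero_left h0]
        exact (dvd_mul_right _ _).neg_right
    obtain ⟨x, hx⟩ := hdvd
    rw [X_pow_eq_monomial] at hx
    have hxmem : x ∈ coverPower k t s := by
      intro a ha
      rw [← cons_sum_sub_single_add hl s s.le_succ]
      refine y.2 (Finsupp.single l (s + 1) + a) ?_
      rwa [hx, mem_support_iff, coeff_monomial_mul, one_mul, ← mem_support_iff]
    refine ⟨⟨x, hxmem⟩, Prod.ext (Subtype.ext hx.symm) (Subtype.ext ?_)⟩
    refine mul_left_cancel₀ (a := monomial (Finsupp.single l (s + 1)) (1 : k)) (by simp) ?_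
    change _ * -(monomial (sqfreeExp t) 1 * x) = _
    rw [eq_neg_of_add_eq_zero_right h0, hx]
    ring
  · rintro ⟨x, hx⟩
    rw [← hx]
    refine Subtype.ext ?_
    change monomial _ 1 * (monomial _ 1 * (x : MvPolynomial σ k)) +
      monomial _ 1 * -(monomial _ 1 * (x : MvPolynomial σ k)) = 0
    ring

lemma coverPowerSum_surjective : Function.Surjective (coverPowerSum k hl s) := by
  suffices h : coverPower k (t.cons l hl) (s + 1) ≤
      LinearMap.range ((coverPower k (t.cons l hl) (s + 1)).subtype ∘ₗ coverPowerSum k hl s) by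
    intro f
    obtain ⟨x, hx⟩ := h f.2
    exact ⟨x, Subtype.ext hx⟩
  intro f hf
  rw [f.as_sum]
  refine Submodule.sum_mem _ fun a ha => ?_
  have hle := hf a ha
  rw [Finset.sum_cons] at hle
  rcases lt_or_ge (a l) (s + 1) with hal | hal
  · have hpos : sqfreeExp t ≤ a := by
      intro i
      by_cases hi : i ∈ t
      · rw [sqfreeExp_apply_of_mem hi]
        have := Finset.single_le_sum (f := fun i => s + 1 - a i) (fun _ _ => Nat.zero_le _) hi
        lia
      · rw [sqfreeExp_apply_of_notMem hi]
        exact Nat.zero_le _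
    obtain ⟨b, rfl⟩ := exists_add_of_le hpos
    simp only [Finsupp.add_apply, sum_succ_sub_sqfreeExp_add, sqfreeExp_apply_of_notMem hl] at hle
    rw [Finsupp.add_apply, sqfreeExp_apply_of_notMem hl] at hal
    refine ⟨(⟨monomial b (f.coeff (sqfreeExp t + b)), monomial_mem_coverPower ?_⟩, 0), ?_⟩
    · rw [Finset.sum_cons]
      lia
    · simp [coverPowerSum, monomial_mul]
  · obtain ⟨b, rfl⟩ := exists_add_of_le (Finsupp.single_le_iff.mpr hal)
    refine ⟨(0, ⟨monomial b (f.coeff (Finsupp.single l (s + 1) + b)),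
      monomial_mem_coverPower ?_⟩), ?_⟩
    · rw [← sum_sub_single_add hl (r := s + 1)]
      exact le_of_add_le_right hle
    · simp [coverPowerSum, monomial_mul]

lemma coverPowerSyz_eq_smul_add_smul [DecidableEq σ] {j : σ} (hj : j ∈ t) :
    ∃ u v : coverPower k t s →ₗ[MvPolynomial σ k]
        coverPower k (t.cons l hl) s × coverPower k t (s + 1),
      coverPowerSyz k hl s =
        (X l : MvPolynomial σ k) • u + (X j : MvPolynomial σ k) • v := by
  refine ⟨(coverPowerMul k (Finsupp.single l s) fun a ha => by
      rwa [cons_sum_sub_single_add hl s le_rfl]).prod 0,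
    (0 : coverPower k t s →ₗ[MvPolynomial σ k] _).prod
      (-coverPowerMul k (sqfreeExp (t.erase j)) (sum_succ_sub_sqfreeExp_erase_add_le s hj)), ?_⟩
  have hexp : sqfreeExp t = Finsupp.single j 1 + sqfreeExp (t.erase j) := by
    ext i
    rcases eq_or_ne i j with rfl | hij
    · simp [sqfreeExp, hj]
    · simp [sqfreeExp, hij, Finsupp.indicator_apply]
  have hmul (i : σ) (m : σ →₀ ℕ) :
      monomial (Finsupp.single i 1 + m) (1 : k) = X i * monomial m 1 := by
    rw [X, monomial_mul, one_mul]
  refine LinearMap.ext fun x => Prod.ext (Subtype.ext ?_) (Subtype.ext ?_)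
  · change monomial _ 1 * (x : MvPolynomial σ k) =
      X l * (monomial _ 1 * (x : MvPolynomial σ k)) + X j * 0
    rw [add_comm s 1, Finsupp.single_add, hmul]
    ring
  · change -(monomial _ 1 * (x : MvPolynomial σ k)) =
      X l * 0 + X j * -(monomial _ 1 * (x : MvPolynomial σ k))
    rw [hexp, hmul]
    ring

end Pascal

end Monomial

section Resolution

universe u

lemma map_eq_zero_of_constantCoeff_eq_zero {k σ ι : Type*} [Field k]
    (φ : (ι →₀ MvPolynomial σ k) →ₗ[MvPolynomial σ k] OriginResidue σ k)
    {x : ι →₀ MvPolynomial σ k} (hx : ∀ q, constantCoeff (x q) = 0) : φ x = 0 := by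
  rw [← Finsupp.sum_single x, Finsupp.sum, map_sum]
  refine Finset.sum_eq_zero fun q _ => ?_
  rw [← mul_one (x q), ← smul_eq_mul, ← Finsupp.smul_single, map_smul,
    smul_originResidue_eq_zero (hx q)]

variable {k : Type u} [Field k] {n : ℕ}

lemma moduleExt_subsingleton_succ_iff_of_finsupp {ι : Type} {N : Type u} [AddCommGroup N]
    [Module (MvPolynomial (Fin n) k) N]
    {g : (ι →₀ MvPolynomial (Fin n) k) →ₗ[MvPolynomial (Fin n) k] N}
    (hg : Function.Surjective g)
    {L : Submodule (MvPolynomial (Fin n) k) (ι →₀ MvPolynomial (Fin n) k)}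
    (hL : LinearMap.ker g = L) (hmin : ∀ x ∈ L, ∀ q, constantCoeff (x q) = 0) (i : ℕ) :
    Subsingleton (ModuleExt (MvPolynomial (Fin n) k) N (OriginResidue (Fin n) k) (i + 1)) ↔
      Subsingleton (ModuleExt (MvPolynomial (Fin n) k) L (OriginResidue (Fin n) k) i) := by
  refine moduleExt_subsingleton_succ_iff L.injective_subtype (g := g) ?_ hg (fun φ => ?_) i
  · rw [LinearMap.exact_iff, Submodule.range_subtype, hL]
  · ext x
    exact map_eq_zero_of_constantCoeff_eq_zero φ (hmin x x.2)

/-- In positive degrees, the ranks of a minimal free resolution of `M` vanish exactly when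
`Ext(M, k)` does. -/
theorem IsMinimalFreeResolution.eq_zero_iff {b : ℕ → ℕ} {M : Type u} [AddCommGroup M]
    [Module (MvPolynomial (Fin n) k) M] (h : IsMinimalFreeResolution k n b M) (i : ℕ) :
    b (i + 1) = 0 ↔
      Subsingleton (ModuleExt (MvPolynomial (Fin n) k) M (OriginResidue (Fin n) k) (i + 1)) := by
  obtain ⟨d, ε, hε, hε0, hd, hmin⟩ := h
  have hmin' (i : ℕ) : ∀ x ∈ LinearMap.range (d i), ∀ q, constantCoeff (x q) = 0 := by
    rintro _ ⟨x, rfl⟩ q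
    induction x using Finsupp.induction_linear with
    | zero => simp
    | add x y hx hy => simp [hx, hy]
    | single p c =>
      rw [← mul_one c, ← smul_eq_mul, ← Finsupp.smul_single, map_smul, Finsupp.smul_apply,
        smul_eq_mul, map_mul, hmin, mul_zero]
  have hker (i : ℕ) : LinearMap.ker (d i).rangeRestrict = LinearMap.range (d (i + 1)) := by
    rw [LinearMap.ker_rangeRestrict, hd]
  have key (j : ℕ) : ∀ i, Subsingleton (ModuleExt (MvPolynomial (Fin n) k)
      (LinearMap.range (d i)) (OriginResidue (Fin n) k) j) ↔ b (i + j + 1) = 0 := by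
    induction j with
    | zero =>
      intro i
      rw [moduleExt_zero_subsingleton_iff_of_surjective (d i).surjective_rangeRestrict,
        moduleExt_zero_finsupp_subsingleton_iff, add_zero]
      intro φ x hx
      rw [hker] at hx
      exact map_eq_zero_of_constantCoeff_eq_zero φ (hmin' _ x hx)
    | succ j ih =>
      intro i
      rw [moduleExt_subsingleton_succ_iff_of_finsupp (d i).surjective_rangeRestrict (hker i)
        (hmin' _), ih, add_right_comm i 1 j, add_assoc i j 1]
  rw [moduleExt_subsingleton_succ_iff_of_finsupp hε hε0 (hmin' 0), key, zero_add]

end Resolution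

section CoverIdeal

universe u

variable {k : Type u} [Field k] {n : ℕ}

/-- The top nonvanishing `Ext` into the residue field of `coverPower k t s`. -/
theorem coverPower_moduleExt {t : Finset (Fin n)} (ht : t.Nonempty) : ∀ s,
    (∀ i, min s (t.card - 1) < i → Subsingleton
      (ModuleExt (MvPolynomial (Fin n) k) (coverPower k t s) (OriginResidue (Fin n) k) i)) ∧
    ¬ Subsingleton (ModuleExt (MvPolynomial (Fin n) k) (coverPower k t s)
      (OriginResidue (Fin n) k) (min s (t.card - 1))) := by
  induction ht using Finset.Nonempty.cons_induction with
  | singleton j =>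
    intro s
    have htop : coverPower k {j} s = ⊤ := by
      refine eq_top_iff.mpr fun f _ a _ => ?_
      simp
    simp [moduleExt_top_subsingleton_iff htop]
  | cons l t hl ht ih =>
    intro s
    induction s with
    | zero =>
      have htop : coverPower k (t.cons l hl) 0 = ⊤ := by
        refine eq_top_iff.mpr fun f _ a _ => ?_
        simp
      simp [moduleExt_top_subsingleton_iff htop]
    | succ s ihs =>
      have hcard : (t.cons l hl).card - 1 = t.card - 1 + 1 := by
        rw [Finset.card_cons, Nat.sub_add_cancel ht.card_pos, Nat.add_sub_cancel]
      rw [hcard] at ihs ⊢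
      constructor
      · intro i hi
        obtain ⟨i, rfl⟩ := Nat.exists_eq_add_one_of_ne_zero (show i ≠ 0 by lia)
        refine moduleExt_subsingleton_right (coverPowerSyz_injective k hl s)
          (coverPower_exact k hl s) (coverPowerSum_surjective k hl s)
          ((ih s).1 i (by lia)) ?_
        exact moduleExt_subsingleton_middle LinearMap.inl_injective Function.Exact.inl_snd
          LinearMap.snd_surjective (ihs.1 _ (by lia)) ((ih (s + 1)).1 _ (by lia))
      · rw [min_add_add_right]
        refine fun h => (ih s).2 (moduleExt_subsingleton_left (coverPowerSyz_injective k hl s)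
          (coverPower_exact k hl s) (coverPowerSum_surjective k hl s) (fun x => ?_) h)
        obtain ⟨j, hj⟩ := ht
        obtain ⟨u, v, huv⟩ := coverPowerSyz_eq_smul_add_smul k hl s hj
        have hX (i : Fin n) := smul_originResidue_eq_zero (constantCoeff_X (R := k) i)
        have hof : ModuleCat.ofHom (coverPowerSyz k hl s) =
            (X l : MvPolynomial (Fin n) k) • ModuleCat.ofHom u +
              (X j : MvPolynomial (Fin n) k) • ModuleCat.ofHom v := by
          rw [huv]
          rfl
        rw [hof, CategoryTheory.Abelian.Ext.mk₀_add, CategoryTheory.Abelian.Ext.add_comp,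
          CategoryTheory.Abelian.Ext.mk₀_smul, CategoryTheory.Abelian.Ext.mk₀_smul,
          CategoryTheory.Abelian.Ext.smul_comp, CategoryTheory.Abelian.Ext.smul_comp,
          moduleExt_smul_eq_zero (hX l), moduleExt_smul_eq_zero (hX j), add_zero]

lemma prod_erase_X_eq_monomial (i : Fin n) :
    ∏ j ∈ Finset.univ.erase i, (X j : MvPolynomial (Fin n) k) =
      monomial (sqfreeExp (Finset.univ.erase i)) 1 := by
  rw [monomial_eq, C_1, one_mul, Finsupp.prod_fintype _ _ (by simp),
    ← Finset.mul_prod_erase _ _ (Finset.mem_univ i),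
    sqfreeExp_apply_of_notMem (Finset.notMem_erase i _), pow_zero, one_mul]
  refine Finset.prod_congr rfl fun j hj => ?_
  rw [sqfreeExp_apply_of_mem hj, pow_one]

/-- The powers of the cover ideal of the complete graph are the monomial ideals `coverPower`. -/
theorem span_prod_erase_pow_eq_coverPower (hn : 0 < n) (s : ℕ) :
    (Ideal.span (Set.range fun i : Fin n =>
      ∏ j ∈ Finset.univ.erase i, (X j : MvPolynomial (Fin n) k))) ^ s =
      coverPower k Finset.univ s := by
  induction s with
  | zero =>
    rw [pow_zero, Ideal.one_eq_top, eq_comm, eq_top_iff]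
    intro f _ a _
    simp
  | succ s ih =>
    rw [pow_succ', ih]
    apply le_antisymm
    · refine Ideal.mul_le.mpr fun r hr f hf => ?_
      induction hr using Submodule.span_induction with
      | mem _ h =>
        obtain ⟨i, rfl⟩ := h
        dsimp only
        rw [prod_erase_X_eq_monomial]
        exact monomial_mul_mem_coverPower
          (sum_succ_sub_sqfreeExp_erase_add_le s (Finset.mem_univ i)) hf
      | zero => simp
      | add _ _ _ _ hp hq =>
        rw [add_mul]
        exact add_mem hp hq
      | smul c _ _ hp =>
        rw [smul_eq_mul, mul_assoc]
        exact Ideal.mul_mem_left _ c hp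
    · intro f hf
      rw [f.as_sum]
      refine Submodule.sum_mem _ fun a ha => ?_
      have hle := hf a ha
      obtain ⟨i, hi, hsum⟩ : ∃ i, (∀ j ≠ i, 0 < a j) ∧
          ∑ j ∈ Finset.univ.erase i, (s + 1 - a j) + (s - a i) ≤ s := by
        rcases Nat.lt_or_ge s (∑ j, (s + 1 - a j)) with hs | hs
        · obtain ⟨i, -, hi⟩ := Finset.exists_ne_zero_of_sum_ne_zero (Nat.ne_zero_of_lt hs)
          rw [← Finset.sum_erase_add _ _ (Finset.mem_univ i)] at hle
          refine ⟨i, fun j hj => ?_, by lia⟩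
          have := Finset.single_le_sum (f := fun j => s + 1 - a j) (fun _ _ => Nat.zero_le _)
            (Finset.mem_erase.mpr ⟨hj, Finset.mem_univ j⟩)
          lia
        · refine ⟨⟨0, hn⟩, fun j _ => ?_, ?_⟩
          · have := Finset.single_le_sum (f := fun j => s + 1 - a j) (fun _ _ => Nat.zero_le _)
              (Finset.mem_univ j)
            lia
          · rw [← Finset.sum_erase_add _ _ (Finset.mem_univ ⟨0, hn⟩)] at hs
            lia
      have hpos : sqfreeExp (Finset.univ.erase i) ≤ a := by
        intro j
        rcases eq_or_ne j i with rfl | hj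
        · rw [sqfreeExp_apply_of_notMem (Finset.notMem_erase _ _)]
          exact Nat.zero_le _
        · rw [sqfreeExp_apply_of_mem (Finset.mem_erase.mpr ⟨hj, Finset.mem_univ j⟩)]
          exact hi j hj
      obtain ⟨b, rfl⟩ := exists_add_of_le hpos
      rw [← one_mul (coeff _ f), ← monomial_mul]
      refine Ideal.mul_mem_mul (Ideal.subset_span ⟨i, prod_erase_X_eq_monomial i⟩)
        (monomial_mem_coverPower ?_)
      simp only [Finsupp.add_apply, sum_succ_sub_sqfreeExp_add,
        sqfreeExp_apply_of_notMem (Finset.notMem_erase i _), zero_add] at hsum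
      rwa [Finset.sum_erase_add _ _ (Finset.mem_univ i)] at hsum

lemma coverPower_univ_le_ker_constantCoeff (hn : 2 ≤ n) {s : ℕ} (hs : 1 ≤ s) :
    coverPower k (Finset.univ : Finset (Fin n)) s ≤ RingHom.ker constantCoeff := by
  intro f hf
  by_contra h
  have := hf 0 (by rwa [mem_support_iff])
  simp only [Finsupp.zero_apply, Nat.sub_zero, Finset.sum_const, Finset.card_univ,
    Fintype.card_fin, smul_eq_mul] at this
  nlinarith

lemma moduleExt_quotient_subsingleton_succ_iff {I : Ideal (MvPolynomial (Fin n) k)}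
    (hI : I ≤ RingHom.ker constantCoeff) (i : ℕ) :
    Subsingleton (ModuleExt (MvPolynomial (Fin n) k) (MvPolynomial (Fin n) k ⧸ I)
        (OriginResidue (Fin n) k) (i + 1)) ↔
      Subsingleton (ModuleExt (MvPolynomial (Fin n) k) I (OriginResidue (Fin n) k) i) := by
  refine moduleExt_subsingleton_succ_iff I.injective_subtype (g := I.mkQ) ?_ I.mkQ_surjective
    (fun φ => ?_) i
  · rw [LinearMap.exact_iff, Submodule.range_subtype, Submodule.ker_mkQ]
  · ext x
    rw [LinearMap.comp_apply, Submodule.subtype_apply, ← mul_one (x : MvPolynomial (Fin n) k),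
      ← smul_eq_mul, map_smul]
    exact smul_originResidue_eq_zero (hI x.2) _

end CoverIdeal

/-- The projective dimension of `S/J(K_n)^s`, where `J(K_n)` is the cover ideal
of the complete graph on `n` vertices, is `s + 1` if `s < n - 1` and `n`
otherwise: the top nonvanishing total Betti number of a minimal free
resolution occurs in that homological degree. -/
theorem pdim_power_cover_ideal_complete_graph
    {k : Type*} [Field k] (n s : ℕ) (hn : 2 ≤ n) (hs : 1 ≤ s)
    (J : Ideal (MvPolynomial (Fin n) k))
    (hJ : J = Ideal.span (Set.range fun i : Fin n =>
        ∏ j ∈ Finset.univ.erase i, X j))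
    (b : ℕ → ℕ)
    (hb : IsMinimalFreeResolution k n b (MvPolynomial (Fin n) k ⧸ (J ^ s))) :
    (if s < n - 1 then (b (s + 1) ≠ 0 ∧ ∀ i, s + 1 < i → b i = 0)
      else (b n ≠ 0 ∧ ∀ i, n < i → b i = 0)) := by
  have hI : J ^ s = coverPower k Finset.univ s := by
    rw [hJ, span_prod_erase_pow_eq_coverPower (by lia)]
  rw [hI] at hb
  have hb' (i : ℕ) : b (i + 2) = 0 ↔ _ := (hb.eq_zero_iff (i + 1)).trans
    (moduleExt_quotient_subsingleton_succ_iff (coverPower_univ_le_ker_constantCoeff hn hs) (i + 1))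
  obtain ⟨hvanish, htop⟩ := coverPower_moduleExt (k := k) (t := (Finset.univ : Finset (Fin n)))
    ⟨⟨0, by lia⟩, Finset.mem_univ _⟩ s
  rw [Finset.card_univ, Fintype.card_fin] at hvanish htop
  obtain ⟨m, hm⟩ := Nat.exists_eq_add_one_of_ne_zero (show min s (n - 1) ≠ 0 by lia)
  rw [hm] at hvanish htop
  have hne : b (m + 2) ≠ 0 := fun h => htop ((hb' m).mp h)
  have hzero (i : ℕ) (hi : m + 2 < i) : b i = 0 := by
    obtain ⟨i, rfl⟩ := Nat.exists_eq_add_of_le' (show 2 ≤ i by lia)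
    exact (hb' i).mpr (hvanish _ (by lia))
  split_ifs with h
  · rw [show s + 1 = m + 2 by lia]
    exact ⟨hne, hzero⟩
  · obtain rfl : n = m + 2 := by lia
    exact ⟨hne, hzero⟩
end

section
/- Let J ⊆ k[X_1,…,X_n] be a squarefree monomial ideal generated in degree n−2 whose associated graph G_J (with an edge {i,j} for each generator with complementary support {i,j}) is a tree. Then the defining ideal K of the Rees algebra R(J) = S[T_1,…,T_{n-1}]/K is generated by a regular sequence of n−2 elements of bidegree (1,1); i.e., R(J) is a quadratic complete intersection. -/
open MvPolynomial

namespace MvPolynomial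

section Supported

variable {σ R : Type*} [CommRing R]

/-- Algebra maps that agree on the variables in `s` agree on `supported R s`. -/
theorem algHom_eqOn_supported {B : Type*} [CommRing B] [Algebra R B] {s : Set σ}
    {f g : MvPolynomial σ R →ₐ[R] B} (h : ∀ i ∈ s, f (X i) = g (X i)) {p : MvPolynomial σ R}
    (hp : p ∈ supported R s) : f p = g p :=
  AlgHom.eqOn_adjoin_iff.mpr (by rintro _ ⟨i, hi, rfl⟩; exact h i hi) hp

/-- Substitute `0` for the variable `x`. -/
noncomputable def killVar [DecidableEq σ] (x : σ) : MvPolynomial σ R →ₐ[R] MvPolynomial σ R :=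
  aeval (Function.update X x 0)

variable [DecidableEq σ]

theorem killVar_X_self (x : σ) : killVar x (X x : MvPolynomial σ R) = 0 := by
  simp [killVar]

theorem killVar_eq_self {x : σ} {s : Set σ} (hx : x ∉ s) {p : MvPolynomial σ R}
    (hp : p ∈ supported R s) : killVar x p = p := by
  refine algHom_eqOn_supported (g := AlgHom.id R _) (fun i hi => ?_) hp
  have : i ≠ x := fun h => hx (h ▸ hi)
  simp [killVar, this]

theorem X_dvd_sub_killVar (x : σ) (p : MvPolynomial σ R) : X x ∣ p - killVar x p := by
  induction p using MvPolynomial.induction_on with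
  | C a => simp [killVar]
  | add p q hp hq =>
    rw [map_add, add_sub_add_comm]
    exact dvd_add hp hq
  | mul_X p i hp =>
    rcases eq_or_ne i x with rfl | hi
    · simp [killVar]
    · have : killVar x (X i : MvPolynomial σ R) = X i := by simp [killVar, hi]
      rw [map_mul, this, ← sub_mul]
      exact hp.mul_right _

theorem killVar_mem_span {x : σ} {s : Set σ} (hx : x ∉ s) {S : Set (MvPolynomial σ R)}
    (hS : S ⊆ supported R s) {p : MvPolynomial σ R} (hp : p ∈ Ideal.span S) :
    killVar x p ∈ Ideal.span S := by
  have : Ideal.span S ≤ (Ideal.span S).comap (killVar x) := by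
    rw [Ideal.span_le]
    intro g hg
    simpa [killVar_eq_self hx (hS hg)] using Ideal.subset_span hg
  exact this hp

end Supported

section LinearExtension

variable {σ k : Type*} [Field k] {s : Set σ} {S : Set (MvPolynomial σ k)} {x y : σ}
  {b : MvPolynomial σ k}

theorem X_mul_X_sub_notMem_span (hS : S ⊆ supported k s) (hx : x ∉ s)
    (hb : b ∈ supported k s) (hbI : b ∉ Ideal.span S) : X x * X y - b ∉ Ideal.span S := by
  classical
  intro h
  have := killVar_mem_span hx hS h
  rw [map_sub, map_mul, killVar_X_self, killVar_eq_self hx hb, zero_mul, zero_sub,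
    neg_mem_iff] at this
  exact hbI this

/-- The variable `x` is a nonzerodivisor modulo `S` and `x y - b`. -/
theorem mem_of_X_mul_mem_span_sup (hS : S ⊆ supported k s) (hprime : (Ideal.span S).IsPrime)
    (hx : x ∉ s) (hxI : X x ∉ Ideal.span S)
    (hb : b ∈ supported k s) (hbI : b ∉ Ideal.span S) {f : MvPolynomial σ k}
    (hf : X x * f ∈ Ideal.span S ⊔ Ideal.span {X x * X y - b}) :
    f ∈ Ideal.span S ⊔ Ideal.span {X x * X y - b} := by
  classical
  obtain ⟨i, hi, j, hj, hij⟩ := Submodule.mem_sup.mp hf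
  obtain ⟨h, rfl⟩ := Ideal.mem_span_singleton'.mp hj
  have hbh : b * killVar x h ∈ Ideal.span S := by
    have key := congrArg (killVar x) hij
    simp only [map_add, map_mul, map_sub, killVar_X_self, killVar_eq_self hx hb] at key
    have : b * killVar x h = killVar x i := by linear_combination -key
    rw [this]
    exact killVar_mem_span hx hS hi
  have hh := (hprime.mem_or_mem hbh).resolve_left hbI
  obtain ⟨h', hh'⟩ := X_dvd_sub_killVar x h
  have hmem : X x * (f - h' * (X x * X y - b)) ∈ Ideal.span S := by
    have : X x * (f - h' * (X x * X y - b)) = i + (X x * X y - b) * killVar x h := by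
      linear_combination -hij + (X x * X y - b) * hh'
    rw [this]
    exact add_mem hi (Ideal.mul_mem_left _ _ hh)
  have := (hprime.mem_or_mem hmem).resolve_left hxI
  rw [← sub_add_cancel f (h' * (X x * X y - b))]
  exact add_mem (Ideal.mem_sup_left this)
    (Ideal.mem_sup_right (Ideal.mul_mem_left _ _ (Ideal.mem_span_singleton_self _)))

/-- If `S` generates a prime ideal and does not involve the variables `x` and `y`, then adding
`x y - b` to it, for some `b` outside of this ideal not involving `x` and `y`, gives a set that
generates a prime ideal. -/
theorem isPrime_span_sup (hS : S ⊆ supported k s) (hprime : (Ideal.span S).IsPrime)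
    (hx : x ∉ s) (hy : y ∉ s) (hxy : x ≠ y) (hxI : X x ∉ Ideal.span S)
    (hb : b ∈ supported k s) (hbI : b ∉ Ideal.span S) :
    (Ideal.span S ⊔ Ideal.span {X x * X y - b}).IsPrime := by
  classical
  let L := FractionRing (MvPolynomial σ k ⧸ Ideal.span S)
  let ι : MvPolynomial σ k →ₐ[k] L :=
    (IsScalarTower.toAlgHom k (MvPolynomial σ k ⧸ Ideal.span S) L).comp
      (Ideal.Quotient.mkₐ k (Ideal.span S))
  have hι (p) : ι p = 0 ↔ p ∈ Ideal.span S := by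
    change algebraMap _ L (Ideal.Quotient.mk (Ideal.span S) p) = 0 ↔ _
    rw [FaithfulSMul.algebraMap_eq_zero_iff (MvPolynomial σ k ⧸ Ideal.span S) L]
    exact Ideal.Quotient.eq_zero_iff_mem (I := Ideal.span S)
  have hιx : ι (X x) ≠ 0 := by rwa [Ne, hι]
  let θ : MvPolynomial σ k →ₐ[k] L :=
    aeval (Function.update (fun i => ι (X i)) y (ι b / ι (X x)))
  have hθX (i) (hi : i ≠ y) : θ (X i) = ι (X i) := by simp [θ, hi]
  have hθy : θ (X y) = ι b / ι (X x) := by simp [θ]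
  have hθ {p} (hp : p ∈ supported k s) : θ p = ι p :=
    algHom_eqOn_supported (fun i hi => hθX i fun h => hy (h ▸ hi)) hp
  suffices Ideal.span S ⊔ Ideal.span {X x * X y - b} = RingHom.ker θ by
    rw [this]
    exact RingHom.ker_isPrime _
  refine le_antisymm (sup_le ?_ ?_) ?_
  · rw [Ideal.span_le]
    intro g hg
    rw [SetLike.mem_coe, RingHom.mem_ker, hθ (hS hg), hι]
    exact Ideal.subset_span hg
  · rw [Ideal.span_singleton_le_iff_mem, RingHom.mem_ker, map_sub, map_mul, hθX x hxy, hθy, hθ hb,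
      mul_div_cancel₀ _ hιx, sub_self]
  · have hred (f : MvPolynomial σ k) : ∃ (N : ℕ) (r : MvPolynomial σ k),
        X x ^ N * f - r ∈ Ideal.span {X x * X y - b} ∧ θ r = ι r := by
      induction f using MvPolynomial.induction_on with
      | C a => exact ⟨0, C a, by simp, by simp [← algebraMap_eq]⟩
      | add p q hp hq =>
        obtain ⟨N, r, h, hr⟩ := hp
        obtain ⟨M, t, h', ht⟩ := hq
        refine ⟨N + M, X x ^ M * r + X x ^ N * t, ?_, by simp [hr, ht, hθX x hxy]⟩
        convert add_mem (Ideal.mul_mem_left _ (X x ^ M) h) (Ideal.mul_mem_left _ (X x ^ N) h')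
          using 1
        ring
      | mul_X p i hp =>
        obtain ⟨N, r, h, hr⟩ := hp
        rcases eq_or_ne i y with rfl | hi
        · refine ⟨N + 1, r * b, ?_, by simp [hr, hθ hb]⟩
          convert add_mem (Ideal.mul_mem_left _ (X x * X i) h)
            (Ideal.mul_mem_left _ r (Ideal.mem_span_singleton_self (X x * X i - b))) using 1
          ring
        · refine ⟨N, r * X i, ?_, by simp [hr, hθX i hi]⟩
          convert Ideal.mul_mem_left _ (X i) h using 1
          ring
    intro f hf
    obtain ⟨N, r, h, hr⟩ := hred f
    have hmem : X x ^ N * f ∈ Ideal.span S ⊔ Ideal.span {X x * X y - b} := by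
      have hθr : θ r = 0 := by
        obtain ⟨c, hc⟩ := Ideal.mem_span_singleton'.mp h
        have := congrArg θ hc
        simp only [map_sub, map_mul, hθX x hxy, hθy, hθ hb, mul_div_cancel₀ _ hιx, sub_self,
          mul_zero, (RingHom.mem_ker).mp hf, zero_sub] at this
        simpa using this.symm
      rw [← sub_add_cancel (X x ^ N * f) r]
      exact add_mem (Ideal.mem_sup_right h) (Ideal.mem_sup_left ((hι r).mp (hr ▸ hθr)))
    clear h
    induction N with
    | zero => simpa using hmem
    | succ N ih =>
      refine ih (mem_of_X_mul_mem_span_sup hS hprime hx hxI hb hbI ?_)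
      rwa [← mul_assoc, ← pow_succ']

end LinearExtension

section EdgePresentation

variable {V J k : Type*} [Field k]

/-- The product of the two variables indexed by the endpoints of an edge. -/
noncomputable def edgeMonomial (e : Sym2 V) : MvPolynomial V k :=
  (e.map X).mul

@[simp]
theorem edgeMonomial_mk (a b : V) : (edgeMonomial s(a, b) : MvPolynomial V k) = X a * X b := rfl

theorem edgeMonomial_ne_zero (e : Sym2 V) : (edgeMonomial e : MvPolynomial V k) ≠ 0 := by
  induction e using Sym2.ind with
  | _ a b => simp [X_ne_zero]

/-- The bidegrees of the variables of `k[X, T]`. -/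
abbrev bidegree (V J : Type*) : V ⊕ J → ℕ × ℕ :=
  Sum.elim (fun _ => (1, 0)) (fun _ => (0, 1))

/-- The list `L` is a prime, weakly regular sequence of forms of bidegree `(1, 1)` in the kernel of
`φ`, involving only vertices in `U` and edges in `F`, where `F` is the set of edges of a tree on
`U`; and modulo `L` the products `X_a X_b T_j`, for the edges `E j = {a, b}` with `j ∈ F`,
all agree. -/
structure IsPartialPresentation (E : J → Sym2 V)
    (φ : MvPolynomial (V ⊕ J) k →ₐ[k] Polynomial (MvPolynomial V k))
    (L : List (MvPolynomial (V ⊕ J) k)) (U : Finset V) (F : Finset J) : Prop where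
  card_vertices : U.card = L.length + 2
  card_edges : F.card = L.length + 1
  endpoint_mem : ∀ j ∈ F, ∀ v ∈ E j, v ∈ U
  exists_edge : ∀ v ∈ U, ∃ j ∈ F, v ∈ E j
  subset_supported : {g | g ∈ L} ⊆ (supported k (Sum.elim (· ∈ U) (· ∈ F)) : Set _)
  le_ker : Ideal.ofList L ≤ RingHom.ker φ
  isPrime : (Ideal.ofList L).IsPrime
  isWeaklyRegular : RingTheory.Sequence.IsWeaklyRegular (MvPolynomial (V ⊕ J) k) L
  isWeightedHomogeneous : ∀ g ∈ L, IsWeightedHomogeneous (bidegree V J) g (1, 1)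
  exchange : ∀ i ∈ F, ∀ j ∈ F,
    rename Sum.inl (edgeMonomial (E i)) * X (Sum.inr i) -
      rename Sum.inl (edgeMonomial (E j)) * X (Sum.inr j) ∈ Ideal.ofList L

/-- Appending to a weakly regular sequence an element outside of the prime ideal it generates. -/
theorem isWeaklyRegular_append_of_isPrime {A : Type*} [CommRing A] {L : List A}
    (hL : RingTheory.Sequence.IsWeaklyRegular A L) (hprime : (Ideal.ofList L).IsPrime) {g : A}
    (hg : g ∉ Ideal.ofList L) : RingTheory.Sequence.IsWeaklyRegular A (L ++ [g]) := by
  rw [RingTheory.Sequence.isWeaklyRegular_append_iff,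
    RingTheory.Sequence.isWeaklyRegular_singleton_iff]
  refine ⟨hL, ?_⟩
  rw [isSMulRegular_quotient_iff_mem_of_smul_mem]
  intro f hf
  rw [smul_eq_mul, Ideal.mul_top] at hf ⊢
  exact (hprime.mem_or_mem hf).resolve_left hg

namespace IsPartialPresentation

variable {E : J → Sym2 V} {φ : MvPolynomial (V ⊕ J) k →ₐ[k] Polynomial (MvPolynomial V k)}
  {u : J → MvPolynomial V k} {P : MvPolynomial V k}

theorem singleEdge [DecidableEq V] {j : J} {a b : V} (hab : a ≠ b) (hj : E j = s(a, b)) :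
    IsPartialPresentation E φ [] {a, b} {j} where
  card_vertices := by simp [Finset.card_pair hab]
  card_edges := by simp
  endpoint_mem := by simp [hj]
  exists_edge := by simp [hj]
  subset_supported := by simp
  le_ker := by simp
  isPrime := by rw [Ideal.ofList_nil]; exact Ideal.isPrime_bot
  isWeaklyRegular := .nil _ _
  isWeightedHomogeneous := by simp
  exchange := by simp

variable {L : List (MvPolynomial (V ⊕ J) k)} {U : Finset V} {F : Finset J}

theorem X_inl_notMem (h : IsPartialPresentation E φ L U F)
    (hφX : ∀ i, φ (X (Sum.inl i)) = Polynomial.C (X i)) (i : V) :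
    X (Sum.inl i) ∉ Ideal.ofList L := fun hi => by
  simpa [hφX, X_ne_zero] using h.le_ker hi

theorem X_inr_notMem (h : IsPartialPresentation E φ L U F)
    (hφT : ∀ j, φ (X (Sum.inr j)) = Polynomial.C (u j) * Polynomial.X)
    (hu : ∀ j, u j ≠ 0) (j : J) :
    X (Sum.inr j) ∉ Ideal.ofList L := fun hj => by
  simpa [hφT, hu] using h.le_ker hj

theorem extend [DecidableEq V] [DecidableEq J] (h : IsPartialPresentation E φ L U F)
    (hφX : ∀ i, φ (X (Sum.inl i)) = Polynomial.C (X i))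
    (hφT : ∀ j, φ (X (Sum.inr j)) = Polynomial.C (u j) * Polynomial.X)
    (hP : P ≠ 0) (hu : ∀ j, edgeMonomial (E j) * u j = P)
    {p v : V} (hp : p ∈ U) (hv : v ∉ U) {i : J} (hi : E i = s(p, v)) :
    ∃ g, IsPartialPresentation E φ (L ++ [g]) (insert v U) (insert i F) := by
  have hu0 (j) : u j ≠ 0 := fun hj => hP (by rw [← hu j, hj, mul_zero])
  obtain ⟨j, hjF, hpj⟩ := h.exists_edge p hp
  obtain ⟨q, hj⟩ := Sym2.mem_iff_exists.mp hpj
  have hq : q ∈ U := h.endpoint_mem j hjF q (by simp [hj])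
  have hiF : i ∉ F := fun hiF => hv (h.endpoint_mem i hiF v (by simp [hi]))
  set s : Set (V ⊕ J) := Sum.elim (· ∈ U) (· ∈ F)
  set s' : Set (V ⊕ J) := Sum.elim (· ∈ insert v U) (· ∈ insert i F)
  have hss' : s ⊆ s' := by
    rintro (w | w) hw
    · exact Finset.mem_insert_of_mem hw
    · exact Finset.mem_insert_of_mem hw
  set b : MvPolynomial (V ⊕ J) k := X (Sum.inl q) * X (Sum.inr j) with hb
  have hbs : b ∈ supported k s :=
    mul_mem (X_mem_supported.mpr hq) (X_mem_supported.mpr hjF)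
  have hbI : b ∉ Ideal.ofList L := fun hb' => (h.isPrime.mem_or_mem hb').elim
    (h.X_inl_notMem hφX q) (h.X_inr_notMem hφT hu0 j)
  set g : MvPolynomial (V ⊕ J) k := X (Sum.inl v) * X (Sum.inr i) - b with hg
  have hvs : Sum.inl v ∉ s := hv
  have his : Sum.inr i ∉ s := hiF
  have hspan : Ideal.ofList (L ++ [g]) = Ideal.ofList L ⊔ Ideal.span {g} := by
    rw [Ideal.ofList_append, Ideal.ofList_singleton]
  have hmono : Ideal.ofList L ≤ Ideal.ofList (L ++ [g]) := hspan ▸ le_sup_left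
  have hgmem : g ∈ Ideal.ofList (L ++ [g]) := Ideal.subset_span (by simp)
  have hexch (l) (hl : l ∈ F) :
      rename Sum.inl (edgeMonomial (E i)) * X (Sum.inr i) -
        rename Sum.inl (edgeMonomial (E l)) * X (Sum.inr l) ∈ Ideal.ofList (L ++ [g]) := by
    convert add_mem (Ideal.mul_mem_left _ (X (Sum.inl p)) hgmem) (hmono (h.exchange j hjF l hl))
      using 1
    simp only [hi, hj, edgeMonomial_mk, map_mul, rename_X, hg, hb]
    ring
  refine ⟨g, ?_, ?_, ?_, ?_, ?_, ?_, ?_, ?_, ?_, ?_⟩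
  · simp [hv, h.card_vertices]
  · simp [hiF, h.card_edges]
  · intro l hl w hw
    rcases Finset.mem_insert.mp hl with rfl | hl
    · rw [hi, Sym2.mem_iff] at hw
      rcases hw with rfl | rfl
      · exact Finset.mem_insert_of_mem hp
      · exact Finset.mem_insert_self _ _
    · exact Finset.mem_insert_of_mem (h.endpoint_mem l hl w hw)
  · intro w hw
    rcases Finset.mem_insert.mp hw with rfl | hw
    · exact ⟨i, Finset.mem_insert_self _ _, by simp [hi]⟩
    · obtain ⟨l, hl, hwl⟩ := h.exists_edge w hw
      exact ⟨l, Finset.mem_insert_of_mem hl, hwl⟩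
  · intro f hf
    rcases List.mem_append.mp hf with hf | hf
    · exact supported_mono hss' (h.subset_supported hf)
    · rw [List.mem_singleton.mp hf]
      exact sub_mem (mul_mem (X_mem_supported.mpr (Finset.mem_insert_self v U))
        (X_mem_supported.mpr (Finset.mem_insert_self i F))) (supported_mono hss' hbs)
  · rw [hspan]
    refine sup_le h.le_ker ?_
    rw [Ideal.span_singleton_le_iff_mem, RingHom.mem_ker]
    have hmul : Polynomial.C (X p) * φ g = 0 := by
      have huu : X p * X v * u i = X p * X q * u j := by
        rw [← edgeMonomial_mk, ← edgeMonomial_mk, ← hi, ← hj, hu, hu]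
      have := congrArg (Polynomial.C (R := MvPolynomial V k)) huu
      simp only [map_mul] at this
      simp only [hg, hb, map_sub, map_mul, hφX, hφT]
      linear_combination Polynomial.X * this
    exact (mul_eq_zero.mp hmul).resolve_left (by simp [X_ne_zero])
  · rw [hspan]
    exact isPrime_span_sup h.subset_supported h.isPrime hvs his (by simp)
      (h.X_inl_notMem hφX v) hbs hbI
  · exact isWeaklyRegular_append_of_isPrime h.isWeaklyRegular h.isPrime
      (X_mul_X_sub_notMem_span h.subset_supported hvs hbs hbI)
  · intro f hf
    rcases List.mem_append.mp hf with hf | hf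
    · exact h.isWeightedHomogeneous f hf
    · rw [List.mem_singleton.mp hf]
      have hom (w : V) (l : J) : IsWeightedHomogeneous (bidegree V J)
          (X (Sum.inl w) * X (Sum.inr l) : MvPolynomial (V ⊕ J) k) (1, 1) :=
        (isWeightedHomogeneous_X k (bidegree V J) (Sum.inl w)).mul
          (isWeightedHomogeneous_X k (bidegree V J) (Sum.inr l))
      exact (weightedHomogeneousSubmodule k (bidegree V J) (1, 1)).sub_mem (hom v i) (hom q j)
  · intro l hl m hm
    rcases Finset.mem_insert.mp hl with rfl | hl'
    · rcases Finset.mem_insert.mp hm with rfl | hm'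
      · simp
      · exact hexch m hm'
    · rcases Finset.mem_insert.mp hm with rfl | hm'
      · rw [← neg_mem_iff, neg_sub]
        exact hexch l hl'
      · exact hmono (h.exchange l hl' m hm')

/-- A partial presentation that uses all edges presents the image of `φ`. -/
theorem ofList_eq_ker (h : IsPartialPresentation E φ L U F)
    (hφX : ∀ i, φ (X (Sum.inl i)) = Polynomial.C (X i))
    (hφT : ∀ j, φ (X (Sum.inr j)) = Polynomial.C (u j) * Polynomial.X)
    (hu : ∀ j, u j ≠ 0) (hF : ∀ j, j ∈ F) :
    Ideal.ofList L = RingHom.ker φ := by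
  obtain ⟨j₀, -⟩ : F.Nonempty := by
    rw [← Finset.card_pos, h.card_edges]
    exact Nat.succ_pos _
  let ρ : Polynomial (MvPolynomial V k) →+* MvPolynomial (V ⊕ J) k :=
    Polynomial.eval₂RingHom (rename Sum.inl : MvPolynomial V k →ₐ[k] _).toRingHom (X (Sum.inr j₀))
  have hρC (p) : ρ (Polynomial.C p) = rename Sum.inl p := by simp [ρ]
  have hρX : ρ Polynomial.X = X (Sum.inr j₀) := by simp [ρ]
  have hφρ (H) : φ (ρ H) = H.comp (Polynomial.C (u j₀) * Polynomial.X) := by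
    have hren (p : MvPolynomial V k) : φ (rename Sum.inl p) = Polynomial.C p := by
      induction p using MvPolynomial.induction_on with
      | C a => simp [← algebraMap_eq, Polynomial.algebraMap_apply]
      | add p q hp hq => simp [hp, hq]
      | mul_X p i hp => simp [hp, hφX]
    induction H using Polynomial.induction_on' with
    | add p q hp hq => simp [hp, hq]
    | monomial m p =>
      rw [← Polynomial.C_mul_X_pow_eq_monomial]
      simp [hρC, hρX, hren, hφT]
  have hedge (j) : rename Sum.inl (edgeMonomial (E j)) ∉ Ideal.ofList L := by
    induction E j using Sym2.ind with
    | _ a b =>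
      simp only [edgeMonomial_mk, map_mul, rename_X]
      exact fun hab => (h.isPrime.mem_or_mem hab).elim (h.X_inl_notMem hφX a)
        (h.X_inl_notMem hφX b)
  have hred (f : MvPolynomial (V ⊕ J) k) : ∃ M H, ρ M ∉ Ideal.ofList L ∧
      ρ M * f - ρ H ∈ Ideal.ofList L := by
    induction f using MvPolynomial.induction_on with
    | C a =>
      refine ⟨1, Polynomial.C (C a), ?_, by simp [hρC]⟩
      rw [map_one]
      exact h.isPrime.one_notMem
    | add p q hp hq =>
      obtain ⟨M, H, hM, hH⟩ := hp
      obtain ⟨M', H', hM', hH'⟩ := hq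
      refine ⟨M * M', M' * H + M * H', ?_, ?_⟩
      · rw [map_mul]
        exact fun hmem => (h.isPrime.mem_or_mem hmem).elim hM hM'
      · convert add_mem (Ideal.mul_mem_left _ (ρ M') hH) (Ideal.mul_mem_left _ (ρ M) hH') using 1
        simp only [map_mul, map_add]
        ring
    | mul_X p i hp =>
      obtain ⟨M, H, hM, hH⟩ := hp
      rcases i with i | j
      · refine ⟨M, H * Polynomial.C (X i), hM, ?_⟩
        convert Ideal.mul_mem_left _ (X (Sum.inl i)) hH using 1
        simp only [map_mul, hρC, rename_X]
        ring
      · refine ⟨M * Polynomial.C (edgeMonomial (E j)),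
          H * Polynomial.C (edgeMonomial (E j₀)) * Polynomial.X, ?_, ?_⟩
        · rw [map_mul, hρC]
          exact fun hmem => (h.isPrime.mem_or_mem hmem).elim hM (hedge j)
        · convert add_mem
            (Ideal.mul_mem_left _ (rename Sum.inl (edgeMonomial (E j)) * X (Sum.inr j)) hH)
            (Ideal.mul_mem_left _ (ρ H) (h.exchange j (hF j) j₀ (hF j₀))) using 1
          simp only [map_mul, hρC, hρX]
          ring
  refine le_antisymm h.le_ker fun f hf => ?_
  obtain ⟨M, H, hM, hH⟩ := hred f
  have hH0 : H = 0 := by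
    have := h.le_ker hH
    rw [RingHom.mem_ker, map_sub, map_mul, (RingHom.mem_ker).mp hf, mul_zero, zero_sub,
      neg_eq_zero, hφρ] at this
    ext1 m
    have hm := congrArg (Polynomial.coeff · m) this
    simpa [Polynomial.comp_C_mul_X_coeff, hu] using hm
  rw [hH0, map_zero, sub_zero] at hH
  exact (h.isPrime.mem_or_mem hH).resolve_left hM

/-- A connected graph has partial presentations of every possible length. -/
theorem exists_of_connected [Fintype V] {G : SimpleGraph V} (hG : G.Connected)
    (hE : Set.range E = G.edgeSet) (hφX : ∀ i, φ (X (Sum.inl i)) = Polynomial.C (X i))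
    (hφT : ∀ j, φ (X (Sum.inr j)) = Polynomial.C (u j) * Polynomial.X)
    (hP : P ≠ 0) (hu : ∀ j, edgeMonomial (E j) * u j = P) (j₀ : J) (m : ℕ)
    (hm : m + 2 ≤ Fintype.card V) :
    ∃ L U F, L.length = m ∧ IsPartialPresentation E φ L U F := by
  classical
  induction m with
  | zero =>
    obtain ⟨a, b, hab⟩ : ∃ a b, E j₀ = s(a, b) :=
      Sym2.ind (f := fun e => ∃ a b, e = s(a, b)) (fun a b => ⟨a, b, rfl⟩) (E j₀)
    have hadj : G.Adj a b := by
      rw [← SimpleGraph.mem_edgeSet, ← hE, ← hab]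
      exact Set.mem_range_self j₀
    exact ⟨[], _, _, rfl, singleEdge hadj.ne hab⟩
  | succ m ih =>
    obtain ⟨L, U, F, rfl, h⟩ := ih (by omega)
    obtain ⟨w, hw⟩ : U.Nonempty := by
      rw [← Finset.card_pos, h.card_vertices]
      omega
    obtain ⟨z, hz⟩ : ∃ z, z ∉ U := by
      by_contra! hall
      have := h.card_vertices
      rw [Finset.eq_univ_iff_forall.mpr hall, Finset.card_univ] at this
      omega
    obtain ⟨walk⟩ := hG.preconnected w z
    obtain ⟨d, -, hd, hd'⟩ := walk.exists_boundary_dart (U : Set V) hw hz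
    obtain ⟨i, hi⟩ : s(d.fst, d.snd) ∈ Set.range E := hE ▸ d.adj
    obtain ⟨g, hg⟩ := h.extend hφX hφT hP hu hd hd' hi
    exact ⟨_, _, _, by simp, hg⟩

theorem isRegular (h : IsPartialPresentation E φ L U F) :
    RingTheory.Sequence.IsRegular (MvPolynomial (V ⊕ J) k) L where
  toIsWeaklyRegular := h.isWeaklyRegular
  top_ne_smul := by
    rw [smul_eq_mul, Ideal.mul_top]
    exact h.isPrime.ne_top.symm

end IsPartialPresentation

end EdgePresentation

end MvPolynomial

open scoped Classical in
/-- Let `J ⊆ S = k[X_1,…,X_n]` be a squarefree monomial ideal generated in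
degree `n - 2` whose associated graph `G_J` is a tree `G` (the generators are
`u_e = ∏_{i ∉ e} X_i` for the `n - 1` edges `e` of `G`, here indexed by `E`).
Present the Rees algebra `R(J) = S[Jt] ⊆ S[t]` as `S[T_1,…,T_{n-1}]/K` via
`T_j ↦ u_j t`.  Then the defining ideal `K` is generated by a regular sequence
of `n - 2` elements which are bihomogeneous of bidegree `(1,1)` (degree `1` in
the `X`-variables and degree `1` in the `T`-variables): `R(J)` is a quadratic
complete intersection. -/
theorem rees_algebra_complete_intersection_of_tree
    {k : Type*} [Field k] (n : ℕ) (hn : 3 ≤ n)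
    (G : SimpleGraph (Fin n)) (hG : G.IsTree)
    (E : Fin (n - 1) → Sym2 (Fin n)) (hEinj : Function.Injective E)
    (hErange : Set.range E = G.edgeSet)
    (φ : MvPolynomial (Fin n ⊕ Fin (n - 1)) k →ₐ[k] Polynomial (MvPolynomial (Fin n) k))
    (hφ : φ = aeval (Sum.elim
      (fun i : Fin n => Polynomial.C (X i))
      (fun j : Fin (n - 1) => Polynomial.C
          (∏ i ∈ Finset.univ.filter (fun i : Fin n => i ∉ E j), X i) *
        Polynomial.X))) :
    ∃ g : Fin (n - 2) → MvPolynomial (Fin n ⊕ Fin (n - 1)) k,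
      RingHom.ker (φ : MvPolynomial (Fin n ⊕ Fin (n - 1)) k →+*
          Polynomial (MvPolynomial (Fin n) k)) = Ideal.span (Set.range g) ∧
      RingTheory.Sequence.IsRegular (MvPolynomial (Fin n ⊕ Fin (n - 1)) k)
        (List.ofFn g) ∧
      ∀ m, IsWeightedHomogeneous
        (Sum.elim (fun _ : Fin n => ((1 : ℕ), (0 : ℕ)))
          (fun _ : Fin (n - 1) => ((0 : ℕ), (1 : ℕ)))) (g m) (1, 1) := by
  classical
  set u : Fin (n - 1) → MvPolynomial (Fin n) k := fun j =>
    ∏ i ∈ Finset.univ.filter (fun i : Fin n => i ∉ E j), X i with hudef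
  have hφX (i) : φ (X (Sum.inl i)) = Polynomial.C (X i) := by simp [hφ]
  have hφT (j) : φ (X (Sum.inr j)) = Polynomial.C (u j) * Polynomial.X := by
    simp only [hφ, aeval_X, Sum.elim_inr, hudef]
  have hP : (∏ i : Fin n, X i : MvPolynomial (Fin n) k) ≠ 0 :=
    Finset.prod_ne_zero_iff.mpr fun i _ => X_ne_zero i
  have hu (j) : edgeMonomial (E j) * u j = ∏ i : Fin n, X i := by
    have hj : E j ∈ G.edgeSet := hErange ▸ Set.mem_range_self j
    simp only [hudef]
    revert hj
    induction E j using Sym2.ind with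
    | _ a b =>
      intro hj
      have hab : a ≠ b := SimpleGraph.Adj.ne (G.mem_edgeSet.mp hj)
      have : Finset.univ.filter (fun i : Fin n => i ∈ s(a, b)) = {a, b} := by
        ext i
        simp
      rw [← Finset.prod_filter_mul_prod_filter_not Finset.univ (fun i : Fin n => i ∈ s(a, b)),
        this, Finset.prod_pair hab, edgeMonomial_mk]
  have hu0 (j) : u j ≠ 0 := fun hj => hP (by rw [← hu j, hj, mul_zero])
  obtain ⟨L, U, F, hL, h⟩ := IsPartialPresentation.exists_of_connected hG.connected hErange hφX hφT
    hP hu ⟨0, by omega⟩ (n - 2) (by rw [Fintype.card_fin]; omega)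
  have hF (j) : j ∈ F := by
    have : F = Finset.univ := by
      rw [← Finset.card_eq_iff_eq_univ, h.card_edges, hL, Fintype.card_fin]
      omega
    exact this ▸ Finset.mem_univ j
  have hofFn : List.ofFn (fun i : Fin (n - 2) => L.get (i.cast hL.symm)) = L := by
    refine List.ext_getElem (by simp [hL]) fun i _ _ => ?_
    simp
  refine ⟨fun i => L.get (i.cast hL.symm), ?_, ?_, fun m => ?_⟩
  · refine (h.ofList_eq_ker hφX hφT hu0 hF).symm.trans ?_
    have hrange : {g | g ∈ L} = Set.range fun i : Fin (n - 2) => L.get (i.cast hL.symm) := by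
      ext f
      rw [Set.mem_range, ← List.mem_ofFn, hofFn, Set.mem_ofPred_eq]
    rw [Ideal.ofList, hrange]
  · rw [hofFn]
    exact h.isRegular
  · exact h.isWeightedHomogeneous _ (List.get_mem _ _)
end

section
/- For a tree T and monomials over its complement: if G_J is a tree on n vertices (so J has n−1 generators of degree n−2 and is of linear type, with Rees algebra a complete intersection of quadrics of bidegree (1,1)), then the x-regularity of R(J) is zero and consequently J^s has a linear resolution for all s ≥ 1. -/
open MvPolynomial

open scoped Classical in
/-- `f`, an element of the free module with basis indexed by `Σ j, Fin (βi j)`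
(where the basis elements over `j` have degree `j`), is homogeneous of degree
`dg` for the weighted grading given by `w`. -/
def HomogOfDeg (k : Type*) [Field k] (n : ℕ) (w : Fin n → ℕ) (βi : ℕ → ℕ) (dg : ℕ)
    (f : ((j : ℕ) × Fin (βi j)) →₀ MvPolynomial (Fin n) k) : Prop :=
  ∀ p : (j : ℕ) × Fin (βi j),
    f p ∈ weightedHomogeneousSubmodule k w (dg - p.1) ∧ (dg < p.1 → f p = 0)

/-- `β : ℕ → ℕ → ℕ` is the table of graded Betti numbers of the graded module
`M` over `S = k[X_1,…,X_n]` (graded by `deg X_i = w i`, with `Hdeg d` the set of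
homogeneous elements of `M` of degree `d`): there is a minimal graded free
resolution of `M` whose `i`-th term has `β i j` basis elements of degree `j`.
Minimality is expressed by all matrix entries of the differentials having zero
constant term. -/
def IsMinimalGradedFreeResolution (k : Type*) [Field k] (n : ℕ) (w : Fin n → ℕ)
    (β : ℕ → ℕ → ℕ) (M : Type*) [AddCommGroup M]
    [Module (MvPolynomial (Fin n) k) M] (Hdeg : ℕ → Set M) : Prop :=
  ∃ (d : (i : ℕ) → (((j : ℕ) × Fin (β (i + 1) j)) →₀ MvPolynomial (Fin n) k)
        →ₗ[MvPolynomial (Fin n) k] (((j : ℕ) × Fin (β i j)) →₀ MvPolynomial (Fin n) k))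
    (ε : (((j : ℕ) × Fin (β 0 j)) →₀ MvPolynomial (Fin n) k) →ₗ[MvPolynomial (Fin n) k] M),
    Function.Surjective ε ∧
    LinearMap.ker ε = LinearMap.range (d 0) ∧
    (∀ i, LinearMap.ker (d i) = LinearMap.range (d (i + 1))) ∧
    (∀ i p q, constantCoeff (d i (Finsupp.single p 1) q) = 0) ∧
    (∀ i dg f, HomogOfDeg k n w (β (i + 1)) dg f → HomogOfDeg k n w (β i) dg (d i f)) ∧
    (∀ dg f, HomogOfDeg k n w (β 0) dg f → ε f ∈ Hdeg dg)

universe u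

section LinearResolutions

variable {k : Type u} [Field k] {n : ℕ}

/-- The elements of degree `d` in the free module of rank one over `k[X_1,…,X_n]` whose
basis element has degree `c`. -/
def shiftedDegree (k : Type u) [Field k] (n c d : ℕ) : AddSubgroup (MvPolynomial (Fin n) k) where
  carrier := {f | ∀ a, coeff a f ≠ 0 → a.degree + c = d}
  zero_mem' := by simp
  add_mem' := by
    intro f g hf hg a ha
    by_cases h : coeff a f = 0
    · exact hg a (by simpa [h] using ha)
    · exact hf a h
  neg_mem' := by
    intro f hf a ha
    exact hf a (by simpa using ha)

theorem mem_shiftedDegree {c d : ℕ} {f : MvPolynomial (Fin n) k} :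
    f ∈ shiftedDegree k n c d ↔ ∀ a, coeff a f ≠ 0 → a.degree + c = d := Iff.rfl

theorem mul_mem_shiftedDegree {c e d : ℕ} {f g : MvPolynomial (Fin n) k}
    (hf : f ∈ shiftedDegree k n e d) (hg : g ∈ shiftedDegree k n c e) :
    f * g ∈ shiftedDegree k n c d := by
  classical
  intro a ha
  rw [coeff_mul] at ha
  obtain ⟨x, hx, hne⟩ := Finset.exists_ne_zero_of_sum_ne_zero ha
  have h1 := hf x.1 (left_ne_zero_of_mul hne)
  have h2 := hg x.2 (right_ne_zero_of_mul hne)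
  rw [← Finset.HasAntidiagonal.mem_antidiagonal.1 hx, map_add]
  omega

theorem one_mem_shiftedDegree (c : ℕ) : (1 : MvPolynomial (Fin n) k) ∈ shiftedDegree k n c c := by
  classical
  intro a ha
  rw [coeff_one] at ha
  have : a = 0 := by
    by_contra h
    exact ha (if_neg (Ne.symm h))
  simp [this]

theorem constantCoeff_eq_zero_of_mem_shiftedDegree {c d : ℕ} (h : d ≠ c)
    {f : MvPolynomial (Fin n) k} (hf : f ∈ shiftedDegree k n c d) : constantCoeff f = 0 := by
  by_contra h0
  have := hf 0 h0
  simp at this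
  exact h this.symm

theorem eq_zero_of_mem_shiftedDegree_self {c : ℕ} {f : MvPolynomial (Fin n) k}
    (hf : f ∈ shiftedDegree k n c c) (h0 : constantCoeff f = 0) : f = 0 := by
  ext a
  by_contra h
  have h1 := hf a (by simpa using h)
  have h2 : a = 0 := by
    rw [← Finsupp.degree_eq_zero_iff]
    omega
  subst h2
  exact h (by simpa [constantCoeff_eq] using h0)

/-- The elements of degree `d` in the free module with basis elements of degrees `c i`. -/
def freeDegree (k : Type u) [Field k] (n : ℕ) {ι : Type} (c : ι → ℕ) (d : ℕ) :
    AddSubgroup (ι →₀ MvPolynomial (Fin n) k) where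
  carrier := {f | ∀ i, f i ∈ shiftedDegree k n (c i) d}
  zero_mem' := fun i => (shiftedDegree k n (c i) d).zero_mem
  add_mem' := fun hf hg i => (shiftedDegree k n (c i) d).add_mem (hf i) (hg i)
  neg_mem' := fun hf i => (shiftedDegree k n (c i) d).neg_mem (hf i)

theorem single_mem_freeDegree {ι : Type} (c : ι → ℕ) (i : ι) :
    Finsupp.single i (1 : MvPolynomial (Fin n) k) ∈ freeDegree k n c (c i) := by
  classical
  intro j
  rw [Finsupp.single_apply]
  split_ifs with h
  · subst h
    exact one_mem_shiftedDegree _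
  · exact AddSubgroup.zero_mem _

section Graded

variable {M : Type u} [AddCommGroup M] [Module (MvPolynomial (Fin n) k) M]
  {N : Type u} [AddCommGroup N] [Module (MvPolynomial (Fin n) k) N]

/-- Multiplying by a form of degree `d - e` sends degree `e` to degree `d`. -/
def IsGradedSMul (H : ℕ → AddSubgroup M) : Prop :=
  ∀ e d, ∀ f ∈ shiftedDegree k n e d, ∀ m ∈ H e, f • m ∈ H d

theorem isGradedSMul_freeDegree {ι : Type} (c : ι → ℕ) :
    IsGradedSMul (k := k) (n := n) (freeDegree k n c) :=
  fun _ _ _ hf _ hm i => mul_mem_shiftedDegree hf (hm i)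

theorem IsGradedSMul.inf_ker {H : ℕ → AddSubgroup M} (hH : IsGradedSMul (k := k) (n := n) H)
    (q : M →ₗ[MvPolynomial (Fin n) k] N) :
    IsGradedSMul (k := k) (n := n) fun d => H d ⊓ (LinearMap.ker q).toAddSubgroup :=
  fun e d f hf m hm => ⟨hH e d f hf m hm.1, (LinearMap.ker q).smul_mem f hm.2⟩

theorem linearCombination_mem {H : ℕ → AddSubgroup M} (hH : IsGradedSMul (k := k) (n := n) H)
    {ι : Type} {c : ι → ℕ} {v : ι → M} (hv : ∀ i, v i ∈ H (c i)) {d : ℕ}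
    {f : ι →₀ MvPolynomial (Fin n) k} (hf : f ∈ freeDegree k n c d) :
    Finsupp.linearCombination (MvPolynomial (Fin n) k) v f ∈ H d := by
  rw [Finsupp.linearCombination_apply]
  exact AddSubgroup.sum_mem _ fun i _ => hH _ _ _ (hf i) _ (hv i)

/-- The graded module with homogeneous elements `H` vanishes below degree `D`, and has a graded
free resolution whose first `p` terms are `S(-D)^b, S(-D-1)^b', …`. -/
def IsLinearUpTo : ℕ → ℕ → ∀ {M : Type u} [AddCommGroup M] [Module (MvPolynomial (Fin n) k) M],
    (ℕ → AddSubgroup M) → Prop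
  | 0, D, _, _, _, H => ∀ d < D, ∀ m ∈ H d, m = 0
  | p + 1, D, M, _, _, H =>
    ∃ (ι : Type) (π : (ι →₀ MvPolynomial (Fin n) k) →ₗ[MvPolynomial (Fin n) k] M),
      (∀ d, ∀ f ∈ freeDegree k n (fun _ : ι => D) d, π f ∈ H d) ∧
      (∀ d, ∀ m ∈ H d, ∃ f ∈ freeDegree k n (fun _ : ι => D) d, π f = m) ∧
      IsLinearUpTo p (D + 1)
        (fun d => freeDegree k n (fun _ : ι => D) d ⊓ (LinearMap.ker π).toAddSubgroup)

theorem IsLinearUpTo.eq_zero_of_lt {p D : ℕ} {H : ℕ → AddSubgroup M}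
    (h : IsLinearUpTo (k := k) (n := n) p D H) {d : ℕ} (hd : d < D) {m : M} (hm : m ∈ H d) :
    m = 0 := by
  cases p with
  | zero => exact h d hd m hm
  | succ p =>
    obtain ⟨ι, π, -, hs, -⟩ := h
    obtain ⟨f, hf, rfl⟩ := hs d m hm
    have : f = 0 := by
      ext i a
      by_contra hne
      have : a.degree + D = d := hf i a (by simpa using hne)
      omega
    simp [this]

theorem isLinearUpTo_of_eq_zero {H : ℕ → AddSubgroup M} (h : ∀ d, ∀ m ∈ H d, m = 0) (p D : ℕ) :
    IsLinearUpTo (k := k) (n := n) p D H := by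
  induction p generalizing D M with
  | zero => exact fun d _ => h d
  | succ p ih =>
    refine ⟨Empty, 0, fun d f _ => by simp, fun d m hm => ⟨0, AddSubgroup.zero_mem _, ?_⟩,
      ih (fun d m _ => Subsingleton.elim _ _) _⟩
    simp [h d m hm]

/-- Linearity is invariant under isomorphisms of graded modules. -/
theorem IsLinearUpTo.map {p D : ℕ} {H : ℕ → AddSubgroup M} {H' : ℕ → AddSubgroup N}
    (h : IsLinearUpTo (k := k) (n := n) p D H) (e : M →ₗ[MvPolynomial (Fin n) k] N)
    (he : ∀ d, ∀ m ∈ H d, e m ∈ H' d) (hs : ∀ d, ∀ m' ∈ H' d, ∃ m ∈ H d, e m = m')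
    (hi : ∀ d, ∀ m ∈ H d, e m = 0 → m = 0) :
    IsLinearUpTo (k := k) (n := n) p D H' := by
  cases p with
  | zero =>
    intro d hd m' hm'
    obtain ⟨m, hm, rfl⟩ := hs d m' hm'
    rw [h d hd m hm, map_zero]
  | succ p =>
    obtain ⟨ι, π, h1, h2, h3⟩ := h
    refine ⟨ι, e ∘ₗ π, fun d f hf => he d _ (h1 d f hf), fun d m' hm' => ?_, ?_⟩
    · obtain ⟨m, hm, rfl⟩ := hs d m' hm'
      obtain ⟨f, hf, rfl⟩ := h2 d m hm
      exact ⟨f, hf, rfl⟩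
    · convert h3 using 2 with d
      ext f
      simp only [AddSubgroup.mem_inf, Submodule.mem_toAddSubgroup, LinearMap.mem_ker,
        LinearMap.comp_apply]
      refine and_congr_right fun hf => ⟨hi d _ (h1 d f hf), fun h => by rw [h, map_zero]⟩

/-- An extension of graded modules with linear resolutions has a linear resolution. -/
theorem IsLinearUpTo.extension {p D : ℕ} {H : ℕ → AddSubgroup M} {H' : ℕ → AddSubgroup N}
    (hH : IsGradedSMul (k := k) (n := n) H) (q : M →ₗ[MvPolynomial (Fin n) k] N)
    (hq : ∀ d, ∀ m ∈ H d, q m ∈ H' d) (hs : ∀ d, ∀ m' ∈ H' d, ∃ m ∈ H d, q m = m')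
    (hker : IsLinearUpTo (k := k) (n := n) p D
      fun d => H d ⊓ (LinearMap.ker q).toAddSubgroup)
    (hquot : IsLinearUpTo (k := k) (n := n) p D H') :
    IsLinearUpTo (k := k) (n := n) p D H := by
  induction p generalizing D M N with
  | zero =>
    intro d hd m hm
    exact hker d hd m ⟨hm, hquot d hd _ (hq d m hm)⟩
  | succ p ih =>
    obtain ⟨α, πA, hA1, hA2, hA3⟩ := hker
    obtain ⟨γ, πC, hC1, hC2, hC3⟩ := hquot
    have hlift : ∀ c : γ, ∃ m ∈ H D, q m = πC (Finsupp.single c 1) := fun c =>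
      hs D _ (hC1 D _ (single_mem_freeDegree (fun _ : γ => D) c))
    choose σ hσ hqσ using hlift
    let e := Finsupp.sumFinsuppLEquivProdFinsupp (M := MvPolynomial (Fin n) k)
      (MvPolynomial (Fin n) k) (α := α) (β := γ)
    let τ := Finsupp.linearCombination (MvPolynomial (Fin n) k) σ
    have hqτ : ∀ f, q (τ f) = πC f := by
      intro f
      have : q ∘ₗ τ = πC := by
        ext c
        simp [τ, hqσ]
      exact LinearMap.congr_fun this f
    have hτ : ∀ d, ∀ f ∈ freeDegree k n (fun _ : γ => D) d, τ f ∈ H d := fun d f hf =>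
      linearCombination_mem hH hσ hf
    let π : (α ⊕ γ →₀ MvPolynomial (Fin n) k) →ₗ[MvPolynomial (Fin n) k] M :=
      (πA.coprod τ) ∘ₗ e.toLinearMap
    have hπ : ∀ f, π f = πA (e f).1 + τ (e f).2 := fun f => rfl
    have he : ∀ d f, f ∈ freeDegree k n (fun _ : α ⊕ γ => D) d ↔
        (e f).1 ∈ freeDegree k n (fun _ : α => D) d ∧
        (e f).2 ∈ freeDegree k n (fun _ : γ => D) d := by
      intro d f
      exact Sum.forall
    have hes : ∀ d g g', g ∈ freeDegree k n (fun _ : α => D) d →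
        g' ∈ freeDegree k n (fun _ : γ => D) d →
        e.symm (g, g') ∈ freeDegree k n (fun _ : α ⊕ γ => D) d := by
      intro d g g' hg hg'
      rw [he, e.apply_symm_apply]
      exact ⟨hg, hg'⟩
    have hπA : ∀ d, ∀ f ∈ freeDegree k n (fun _ : α => D) d, q (πA f) = 0 := fun d f hf =>
      (hA1 d f hf).2
    refine ⟨α ⊕ γ, π, fun d f hf => ?_, fun d m hm => ?_, ?_⟩
    · rw [he] at hf
      exact (H d).add_mem (hA1 d _ hf.1).1 (hτ d _ hf.2)
    · obtain ⟨g', hg', h⟩ := hC2 d _ (hq d m hm)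
      obtain ⟨g, hg, h'⟩ := hA2 d (m - τ g') ⟨(H d).sub_mem hm (hτ d _ hg'), by
        simp [hqτ, h]⟩
      refine ⟨e.symm (g, g'), hes d _ _ hg hg', ?_⟩
      rw [hπ, e.apply_symm_apply, h']
      simp
    · refine ih ((isGradedSMul_freeDegree _).inf_ker π)
        (LinearMap.snd _ _ _ ∘ₗ e.toLinearMap) (fun d f hf => ?_) (fun d g' hg' => ?_)
        ?_ hC3
      · refine ⟨((he d f).1 hf.1).2, ?_⟩
        have h0 : π f = 0 := hf.2
        have h1 := congrArg q h0
        rw [hπ, map_add, hπA d _ ((he d f).1 hf.1).1, hqτ, zero_add, map_zero] at h1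
        exact h1
      · obtain ⟨g, hg, h⟩ := hA2 d (τ g') ⟨hτ d _ hg'.1, by
          have : πC g' = 0 := hg'.2
          simp [hqτ, this]⟩
        refine ⟨e.symm (-g, g'), ⟨hes d _ _ (AddSubgroup.neg_mem _ hg) hg'.1, ?_⟩, ?_⟩
        · change π _ = 0
          rw [hπ, e.apply_symm_apply, map_neg, h]
          simp
        · simp
      · refine hA3.map (e.symm.toLinearMap ∘ₗ LinearMap.inl _ _ _) (fun d g hg => ?_)
          (fun d f hf => ?_) (fun d g _ h0 => ?_)
        · have h0 : πA g = 0 := hg.2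
          refine ⟨⟨hes d _ _ hg.1 (AddSubgroup.zero_mem _), ?_⟩, ?_⟩
          · change π (e.symm (g, 0)) = 0
            rw [hπ, e.apply_symm_apply]
            simp [h0]
          · change (e (e.symm (g, 0))).2 = 0
            rw [e.apply_symm_apply]
        · have h2 : (e f).2 = 0 := hf.2
          have h0 : π f = 0 := hf.1.2
          rw [hπ, h2, map_zero, add_zero] at h0
          refine ⟨(e f).1, ⟨((he d f).1 hf.1.1).1, h0⟩, ?_⟩
          change e.symm ((e f).1, 0) = f
          rw [e.symm_apply_eq, ← h2]
        · have h1 : e.symm (g, 0) = 0 := h0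
          rw [e.symm_apply_eq, map_zero] at h1
          exact congrArg Prod.fst h1

/-- A quotient of a module with a linear resolution generated in degree `D`, by a submodule with a
linear resolution generated in degree `D + 1`, has a linear resolution. -/
theorem IsLinearUpTo.quotient {p D : ℕ} {H : ℕ → AddSubgroup M} {H' : ℕ → AddSubgroup N}
    (q : M →ₗ[MvPolynomial (Fin n) k] N)
    (hq : ∀ d, ∀ m ∈ H d, q m ∈ H' d) (hs : ∀ d, ∀ m' ∈ H' d, ∃ m ∈ H d, q m = m')
    (hker : IsLinearUpTo (k := k) (n := n) p (D + 1)
      fun d => H d ⊓ (LinearMap.ker q).toAddSubgroup)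
    (hH : IsLinearUpTo (k := k) (n := n) (p + 1) D H) :
    IsLinearUpTo (k := k) (n := n) (p + 1) D H' := by
  obtain ⟨ι, π, h1, h2, h3⟩ := hH
  refine ⟨ι, q ∘ₗ π, fun d f hf => hq d _ (h1 d f hf), fun d m' hm' => ?_, ?_⟩
  · obtain ⟨m, hm, rfl⟩ := hs d m' hm'
    obtain ⟨f, hf, rfl⟩ := h2 d m hm
    exact ⟨f, hf, rfl⟩
  · refine IsLinearUpTo.extension ((isGradedSMul_freeDegree _).inf_ker _) π
      (H' := fun d => H d ⊓ (LinearMap.ker q).toAddSubgroup)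
      (fun d f hf => ⟨h1 d f hf.1, hf.2⟩) (fun d m hm => ?_) ?_ hker
    · obtain ⟨f, hf, rfl⟩ := h2 d m hm.1
      exact ⟨f, ⟨hf, hm.2⟩, rfl⟩
    · convert h3 using 2 with d
      ext f
      constructor
      · exact fun hf => ⟨hf.1.1, hf.2⟩
      · intro hf
        have h0 : π f = 0 := hf.2
        exact ⟨⟨hf.1, by simp [h0]⟩, hf.2⟩

end Graded

theorem constantCoeff_apply_eq_zero {ι κ : Type}
    (φ : (ι →₀ MvPolynomial (Fin n) k) →ₗ[MvPolynomial (Fin n) k] κ →₀ MvPolynomial (Fin n) k)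
    {f : ι →₀ MvPolynomial (Fin n) k} {j : κ}
    (hf : ∀ i, constantCoeff (f i) = 0 ∨ constantCoeff (φ (Finsupp.single i 1) j) = 0) :
    constantCoeff (φ f j) = 0 := by
  have h : φ f = f.sum fun i a => a • φ (Finsupp.single i 1) := by
    conv_lhs => rw [← Finsupp.sum_single f]
    rw [Finsupp.sum, map_sum]
    refine Finset.sum_congr rfl fun i _ => ?_
    simp only [← map_smul, Finsupp.smul_single, smul_eq_mul, mul_one]
  rw [h, Finsupp.sum, Finsupp.finsetSum_apply, map_sum]
  refine Finset.sum_eq_zero fun i _ => ?_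
  rw [Finsupp.smul_apply, smul_eq_mul, map_mul]
  rcases hf i with h | h <;> simp [h]

/-- The first step of a minimal graded free resolution of a module with a linear resolution
generated in degree `D`: all basis elements have degree `D`, and the syzygies have a linear
resolution generated in degree `D + 1`. -/
theorem minimal_cover_of_isLinearUpTo {M : Type u} [AddCommGroup M]
    [Module (MvPolynomial (Fin n) k) M] {D : ℕ} {H : ℕ → AddSubgroup M}
    (hH : ∀ p, IsLinearUpTo (k := k) (n := n) p D H) {ι : Type} {c : ι → ℕ}
    (ε : (ι →₀ MvPolynomial (Fin n) k) →ₗ[MvPolynomial (Fin n) k] M)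
    (hε : ∀ d, ∀ f ∈ freeDegree k n c d, ε f ∈ H d)
    (hs : ∀ d, ∀ m ∈ H d, ∃ f ∈ freeDegree k n c d, ε f = m)
    (hmin : ∀ f, ε f = 0 → ∀ i, constantCoeff (f i) = 0) :
    (∀ i, c i = D) ∧ ∀ p, IsLinearUpTo (k := k) (n := n) p (D + 1)
      fun d => freeDegree k n c d ⊓ (LinearMap.ker ε).toAddSubgroup := by
  rw [← forall_and_left]
  intro p
  obtain ⟨κ, π, h1, h2, h3⟩ := hH (p + 1)
  have hφ : ∀ i, ∃ g ∈ freeDegree k n (fun _ : κ => D) (c i), π g = ε (Finsupp.single i 1) :=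
    fun i => h2 _ _ (hε _ _ (single_mem_freeDegree c i))
  have hψ : ∀ j, ∃ f ∈ freeDegree k n c D, ε f = π (Finsupp.single j 1) :=
    fun j => hs _ _ (h1 _ _ (single_mem_freeDegree (fun _ => D) j))
  choose u hu hπu using hφ
  choose v hv hεv using hψ
  let φ := Finsupp.linearCombination (MvPolynomial (Fin n) k) u
  let ψ := Finsupp.linearCombination (MvPolynomial (Fin n) k) v
  have hπφ : ∀ f, π (φ f) = ε f := by
    intro f
    have : π ∘ₗ φ = ε := by
      ext i
      simp [φ, hπu]
    exact LinearMap.congr_fun this f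
  have hεψ : ∀ f, ε (ψ f) = π f := by
    intro f
    have : ε ∘ₗ ψ = π := by
      ext i
      simp [ψ, hεv]
    exact LinearMap.congr_fun this f
  have hφd : ∀ d, ∀ f ∈ freeDegree k n c d, φ f ∈ freeDegree k n (fun _ : κ => D) d :=
    fun d f hf => linearCombination_mem (isGradedSMul_freeDegree _) hu hf
  have hψd : ∀ d, ∀ f ∈ freeDegree k n (fun _ : κ => D) d, ψ f ∈ freeDegree k n c d :=
    fun d f hf => linearCombination_mem (isGradedSMul_freeDegree _) hv hf
  have hcc : ∀ i j, constantCoeff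
      ((ψ (φ (Finsupp.single i 1)) - Finsupp.single i 1 : ι →₀ MvPolynomial (Fin n) k) j) = 0 :=
    fun i => hmin _ (by rw [map_sub, hεψ, hπφ, sub_self])
  have hc : ∀ i, c i = D := by
    intro i
    by_contra hne
    have h0 : constantCoeff (ψ (φ (Finsupp.single i 1)) i) = 0 :=
      constantCoeff_apply_eq_zero ψ fun j => Or.inl
        (constantCoeff_eq_zero_of_mem_shiftedDegree hne
          (hφd _ _ (single_mem_freeDegree c i) j))
    have := hcc i i
    simp [h0] at this
  refine ⟨hc, ?_⟩
  have hψφ : ∀ f, ψ (φ f) = f := by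
    intro f
    have : ψ ∘ₗ φ = LinearMap.id := by
      refine Finsupp.lhom_ext' fun i => LinearMap.ext_ring ?_
      simp only [LinearMap.comp_apply, Finsupp.lsingle_apply, LinearMap.id_apply]
      rw [← sub_eq_zero]
      ext1 j
      refine eq_zero_of_mem_shiftedDegree_self (c := D) ?_ (hcc i j)
      have hi := single_mem_freeDegree (k := k) (n := n) c i
      have := AddSubgroup.sub_mem _ (hψd _ _ (hφd _ _ hi)) hi j
      rwa [hc, hc] at this
    exact LinearMap.congr_fun this f
  have hφψ : ∀ f, φ (ψ f) = f := by
    intro f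
    have : φ ∘ₗ ψ = LinearMap.id := by
      refine Finsupp.lhom_ext' fun j => LinearMap.ext_ring ?_
      simp only [LinearMap.comp_apply, Finsupp.lsingle_apply, LinearMap.id_apply]
      rw [← sub_eq_zero]
      have hj := single_mem_freeDegree (k := k) (n := n) (fun _ : κ => D) j
      refine h3.eq_zero_of_lt (Nat.lt_succ_self D)
        ⟨AddSubgroup.sub_mem _ (hφd _ _ (hψd _ _ hj)) hj, ?_⟩
      change π _ = 0
      rw [map_sub, hπφ, hεψ, sub_self]
    exact LinearMap.congr_fun this f
  refine h3.map ψ (fun d f hf => ⟨hψd d f hf.1, ?_⟩)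
    (fun d f hf => ⟨φ f, ⟨hφd d f hf.1, ?_⟩, hψφ f⟩) (fun d f _ h0 => ?_)
  · have h0 : π f = 0 := hf.2
    change ε _ = 0
    rw [hεψ, h0]
  · have h0 : ε f = 0 := hf.2
    change π _ = 0
    rw [hπφ, h0]
  · rw [← hφψ f, h0, map_zero]

/-- The part of degree `d` of a polynomial, when `1` is given degree `c`. -/
noncomputable def shiftedComponent (k : Type u) [Field k] (n c d : ℕ) :
    MvPolynomial (Fin n) k →+ MvPolynomial (Fin n) k :=
  if c ≤ d then (homogeneousComponent (d - c)).toAddMonoidHom else 0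

theorem coeff_shiftedComponent (c d : ℕ) (f : MvPolynomial (Fin n) k) (a : Fin n →₀ ℕ) :
    coeff a (shiftedComponent k n c d f) = if a.degree + c = d then coeff a f else 0 := by
  unfold shiftedComponent
  by_cases h : c ≤ d
  · rw [if_pos h]
    change coeff a (homogeneousComponent (d - c) f) = _
    rw [coeff_homogeneousComponent]
    refine if_congr ?_ rfl rfl
    omega
  · rw [if_neg h, if_neg (by omega)]
    simp

theorem shiftedComponent_mem (c d : ℕ) (f : MvPolynomial (Fin n) k) :
    shiftedComponent k n c d f ∈ shiftedDegree k n c d := by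
  intro a ha
  rw [coeff_shiftedComponent] at ha
  by_contra h
  exact ha (if_neg h)

theorem shiftedComponent_eq_self {c d : ℕ} {f : MvPolynomial (Fin n) k}
    (hf : f ∈ shiftedDegree k n c d) : shiftedComponent k n c d f = f := by
  ext a
  rw [coeff_shiftedComponent, ite_eq_left_iff]
  intro h
  by_contra h0
  exact h (hf a (Ne.symm h0))

theorem shiftedComponent_eq_zero {c d e : ℕ} (h : e ≠ d) {f : MvPolynomial (Fin n) k}
    (hf : f ∈ shiftedDegree k n c e) : shiftedComponent k n c d f = 0 := by
  ext a
  rw [coeff_shiftedComponent, coeff_zero, ite_eq_right_iff]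
  intro h1
  by_contra h0
  exact h ((hf a h0).symm.trans h1)

/-- The part of degree `d` of an element of the free module with basis elements of degrees
`c i`. -/
noncomputable def freeComponent (k : Type u) [Field k] (n : ℕ) {ι : Type} (c : ι → ℕ) (d : ℕ) :
    (ι →₀ MvPolynomial (Fin n) k) →+ ι →₀ MvPolynomial (Fin n) k where
  toFun f := Finsupp.onFinset f.support (fun i => shiftedComponent k n (c i) d (f i)) <| by
    intro i hi
    rw [Finsupp.mem_support_iff]
    rintro h
    simp [h] at hi
  map_zero' := by ext1 i; simp
  map_add' f g := by ext1 i; simp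

/-- Homogeneous elements in the image of a graded linear map have homogeneous preimages. -/
theorem exists_homogeneous_preimage {ι : Type} {c : ι → ℕ} {M : Type u} [AddCommGroup M]
    [Module (MvPolynomial (Fin n) k) M] {H : ℕ → AddSubgroup M}
    (ε : (ι →₀ MvPolynomial (Fin n) k) →ₗ[MvPolynomial (Fin n) k] M)
    (hε : ∀ d, ∀ f ∈ freeDegree k n c d, ε f ∈ H d) {d : ℕ} (P : M →+ M)
    (hP : ∀ m ∈ H d, P m = m) (hP0 : ∀ e ≠ d, ∀ m ∈ H e, P m = 0)
    {f : ι →₀ MvPolynomial (Fin n) k} (hf : ε f ∈ H d) :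
    ∃ g ∈ freeDegree k n c d, ε g = ε f := by
  refine ⟨freeComponent k n c d f, fun i => shiftedComponent_mem _ _ _, ?_⟩
  rw [← hP _ hf]
  suffices h : ε.toAddMonoidHom.comp (freeComponent k n c d) = P.comp ε.toAddMonoidHom from
    DFunLike.congr_fun h f
  refine Finsupp.addHom_ext' fun i => ?_
  refine AddMonoidHom.ext fun x => ?_
  induction x using MvPolynomial.induction_on' with
  | add x y hx hy => rw [map_add, map_add, hx, hy]
  | monomial a r => ?_
  have hm : Finsupp.single i (monomial a r) ∈ freeDegree k n c (a.degree + c i) := by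
    classical
    intro j b hb
    rw [Finsupp.single_apply] at hb
    split_ifs at hb with h
    · subst h
      rw [coeff_monomial] at hb
      split_ifs at hb with h
      · rw [h]
      · simp at hb
    · simp at hb
  change ε (freeComponent k n c d (Finsupp.single i (monomial a r))) =
    P (ε (Finsupp.single i (monomial a r)))
  by_cases h : a.degree + c i = d
  · subst h
    rw [hP _ (hε _ _ hm)]
    congr 1
    ext1 j
    exact shiftedComponent_eq_self (hm j)
  · rw [hP0 _ h _ (hε _ _ hm)]
    convert map_zero ε
    ext1 j
    exact shiftedComponent_eq_zero h (hm j)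

theorem mem_freeDegree_iff_homogOfDeg {β : ℕ → ℕ} {d : ℕ}
    {f : ((j : ℕ) × Fin (β j)) →₀ MvPolynomial (Fin n) k} :
    f ∈ freeDegree k n (fun p : (j : ℕ) × Fin (β j) => p.1) d ↔
      HomogOfDeg k n (fun _ => 1) β d f := by
  refine forall_congr' fun p => ?_
  rw [mem_shiftedDegree, mem_weightedHomogeneousSubmodule]
  have hw : ∀ a : Fin n →₀ ℕ, Finsupp.weight (fun _ : Fin n => 1) a = a.degree := by
    intro a
    simp [Finsupp.weight_apply, Finsupp.degree_apply, Finsupp.sum]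
  constructor
  · refine fun h => ⟨fun a ha => ?_, fun hd => ?_⟩
    · rw [hw]
      have : a.degree + p.1 = d := h a ha
      omega
    · ext a
      by_contra hne
      have : a.degree + p.1 = d := h a (by simpa using hne)
      omega
  · rintro ⟨h, h'⟩ a ha
    have h1 := h ha
    rw [hw] at h1
    by_cases hd : d < p.1
    · simp [h' hd] at ha
    · change a.degree + p.1 = d
      omega


/-- If the ideal `I` has a linear resolution generated in degree `D`, then every minimal graded
free resolution of `I` is linear. -/
theorem IsMinimalGradedFreeResolution.eq_of_isLinearUpTo {I : Ideal (MvPolynomial (Fin n) k)}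
    {D : ℕ} (hI : ∀ p, IsLinearUpTo (k := k) (n := n) p D
      fun d => shiftedDegree k n 0 d ⊓ Submodule.toAddSubgroup I) {β : ℕ → ℕ → ℕ}
    (hβ : IsMinimalGradedFreeResolution k n (fun _ => 1) β I
      (fun dg => {f : I | (f : MvPolynomial (Fin n) k) ∈
        weightedHomogeneousSubmodule k (fun _ => 1) dg})) (i j : ℕ) (hij : β i j ≠ 0) :
    j = D + i := by
  obtain ⟨d, ε, hsurj, hker0, hker, hmin, hd, hε⟩ := hβ
  let deg (i : ℕ) : ((j : ℕ) × Fin (β i j)) → ℕ := fun p => p.1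
  have hd' : ∀ i dg, ∀ f ∈ freeDegree k n (deg (i + 1)) dg,
      d i f ∈ freeDegree k n (deg i) dg := fun i dg f hf =>
    mem_freeDegree_iff_homogOfDeg.2 (hd i dg f (mem_freeDegree_iff_homogOfDeg.1 hf))
  have hmin' : ∀ i f p, constantCoeff (d i f p) = 0 := fun i f p =>
    constantCoeff_apply_eq_zero (d i) fun q => Or.inr (hmin i q p)
  have key : ∀ i, (∀ p, deg i p = D + i) ∧ ∀ p, IsLinearUpTo (k := k) (n := n) p (D + i + 1)
      fun dg => freeDegree k n (deg i) dg ⊓ (LinearMap.range (d i)).toAddSubgroup := by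
    intro i
    induction i with
    | zero =>
      let ε' : (((j : ℕ) × Fin (β 0 j)) →₀ MvPolynomial (Fin n) k)
          →ₗ[MvPolynomial (Fin n) k] MvPolynomial (Fin n) k := Submodule.subtype I ∘ₗ ε
      have hk : LinearMap.ker ε' = LinearMap.range (d 0) := by
        rw [LinearMap.ker_comp, Submodule.ker_subtype, ← hker0]
        rfl
      have hε' : ∀ dg, ∀ f ∈ freeDegree k n (deg 0) dg,
          ε' f ∈ shiftedDegree k n 0 dg ⊓ Submodule.toAddSubgroup I := by
        intro dg f hf
        refine ⟨fun a ha => ?_, (ε f).2⟩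
        have h := hε dg f (mem_freeDegree_iff_homogOfDeg.1 hf) ha
        simpa [Finsupp.weight_apply, Finsupp.degree_apply, Finsupp.sum] using h
      rw [← hk]
      refine minimal_cover_of_isLinearUpTo hI ε' hε' (fun dg m hm => ?_) (fun f hf => ?_)
      · obtain ⟨f, hf⟩ := hsurj ⟨m, hm.2⟩
        have hf' : ε' f = m := congrArg Subtype.val hf
        rw [← hf'] at hm ⊢
        exact exists_homogeneous_preimage ε' hε' (shiftedComponent k n 0 dg)
          (fun m hm => shiftedComponent_eq_self hm.1)
          (fun e he m hm => shiftedComponent_eq_zero he hm.1) hm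
      · have : f ∈ LinearMap.ker ε' := hf
        rw [hk] at this
        obtain ⟨g, rfl⟩ := this
        exact hmin' 0 g
    | succ i ih =>
      rw [← hker i]
      have hr : ∀ dg, ∀ f ∈ freeDegree k n (deg (i + 1)) dg, d i f ∈
          freeDegree k n (deg i) dg ⊓ (LinearMap.range (d i)).toAddSubgroup :=
        fun dg f hf => ⟨hd' i dg f hf, ⟨f, rfl⟩⟩
      refine minimal_cover_of_isLinearUpTo ih.2 (d i) hr (fun dg m hm => ?_) (fun f hf => ?_)
      · obtain ⟨f, rfl⟩ := hm.2
        refine exists_homogeneous_preimage (d i) hr (freeComponent k n (deg i) dg)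
          (fun m hm => ?_) (fun e he m hm => ?_) hm
        · ext1 p
          exact shiftedComponent_eq_self (hm.1 p)
        · ext1 p
          exact shiftedComponent_eq_zero he (hm.1 p)
      · have : f ∈ LinearMap.ker (d i) := hf
        rw [hker i] at this
        obtain ⟨g, rfl⟩ := this
        exact hmin' (i + 1) g
  exact (key i).1 ⟨j, ⟨0, Nat.pos_of_ne_zero hij⟩⟩

/-- The elements of degree `d` in the ideal generated by the monomials with exponents in `A`,
when `1` is given degree `c`. -/
def monomialDegree (k : Type u) [Field k] {n : ℕ} (A : Set (Fin n →₀ ℕ)) (c d : ℕ) :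
    AddSubgroup (MvPolynomial (Fin n) k) where
  carrier := {f | ∀ m, coeff m f ≠ 0 → m.degree + c = d ∧ ∃ x ∈ A, x ≤ m}
  zero_mem' := by simp
  add_mem' := by
    intro f g hf hg a ha
    by_cases h : coeff a f = 0
    · exact hg a (by simpa [h] using ha)
    · exact hf a h
  neg_mem' := by
    intro f hf a ha
    exact hf a (by simpa using ha)

theorem monomialDegree_eq (A : Set (Fin n →₀ ℕ)) (c d : ℕ) :
    monomialDegree k A c d = shiftedDegree k n c d ⊓
      Submodule.toAddSubgroup (Ideal.span ((fun m => monomial m (1 : k)) '' A)) := by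
  ext f
  simp only [AddSubgroup.mem_inf, Submodule.mem_toAddSubgroup, mem_ideal_span_monomial_image,
    mem_support_iff, mem_shiftedDegree, ← forall_and]
  rfl

theorem isGradedSMul_monomialDegree (A : Set (Fin n →₀ ℕ)) (c : ℕ) :
    IsGradedSMul (k := k) (n := n) (monomialDegree k A c) := by
  intro e d f hf m hm
  rw [monomialDegree_eq] at hm ⊢
  exact ⟨mul_mem_shiftedDegree hf hm.1, Ideal.mul_mem_left _ f hm.2⟩

theorem isLinearUpTo_shiftedDegree (p D : ℕ) :
    IsLinearUpTo (k := k) (n := n) p D (shiftedDegree k n D) := by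
  cases p with
  | zero =>
    intro d hd f hf
    ext a
    by_contra hne
    have := hf a (by simpa using hne)
    omega
  | succ p =>
    refine ⟨Unit, Finsupp.lapply (), fun d f hf => hf (), fun d f hf =>
      ⟨Finsupp.single () f, fun _ => by simpa using hf, by simp⟩,
      isLinearUpTo_of_eq_zero (fun d f hf => ?_) _ _⟩
    exact Finsupp.ext fun _ => hf.2

/-- Adding a monomial generator `u` of the right degree to an ideal `I` with a linear resolution
preserves linearity, if the colon ideal `I : u` has a linear resolution. -/
theorem IsLinearUpTo.insert_monomial {p c D : ℕ} {A B : Set (Fin n →₀ ℕ)} {a : Fin n →₀ ℕ}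
    (hA : IsLinearUpTo (k := k) (n := n) (p + 1) D (monomialDegree k A c))
    (hB : IsLinearUpTo (k := k) (n := n) p (D + 1) (monomialDegree k B D))
    (ha : a.degree + c = D)
    (hcolon : ∀ m, (∃ x ∈ B, x ≤ m) ↔ ∃ x ∈ A, x ≤ m + a) :
    IsLinearUpTo (k := k) (n := n) (p + 1) D (monomialDegree k (insert a A) c) := by
  let S := MvPolynomial (Fin n) k
  let H : ℕ → AddSubgroup (S × S) := fun d => (monomialDegree k A c d).prod (shiftedDegree k n D d)
  let mulA : S →ₗ[S] S := LinearMap.mulLeft S (monomial a (1 : k))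
  have hmulA : ∀ f, mulA f = monomial a (1 : k) * f := fun f => rfl
  have hmulA_mem : ∀ d, ∀ f ∈ shiftedDegree k n D d,
      mulA f ∈ monomialDegree k (insert a A) c d := by
    intro d f hf m hm
    rw [hmulA, coeff_monomial_mul'] at hm
    split_ifs at hm with h
    · have h1 := hf (m - a) (by simpa using hm)
      have h2 : (m - a).degree + a.degree = m.degree := by
        rw [← map_add, tsub_add_cancel_of_le h]
      exact ⟨by omega, a, Set.mem_insert _ _, h⟩
    · simp at hm
  have hmulA_iff : ∀ d, ∀ f ∈ shiftedDegree k n D d,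
      (mulA f ∈ monomialDegree k A c d ↔ f ∈ monomialDegree k B D d) := by
    intro d f hf
    constructor
    · intro h m hm
      refine ⟨hf m hm, (hcolon m).2 ?_⟩
      refine (h (m + a) ?_).2
      rwa [hmulA, add_comm, coeff_monomial_mul, one_mul]
    · intro h m hm
      refine ⟨(hmulA_mem d f hf m hm).1, ?_⟩
      rw [hmulA, coeff_monomial_mul'] at hm
      split_ifs at hm with hle
      · have := (hcolon (m - a)).1 (h (m - a) (by simpa using hm)).2
        rwa [tsub_add_cancel_of_le hle] at this
      · simp at hm
  have hA' : ∀ d, monomialDegree k A c d ≤ monomialDegree k (insert a A) c d := by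
    intro d f hf m hm
    obtain ⟨h, x, hx, hle⟩ := hf m hm
    exact ⟨h, x, Set.mem_insert_of_mem _ hx, hle⟩
  have hHlin : IsLinearUpTo (k := k) (n := n) (p + 1) D H := by
    refine IsLinearUpTo.extension (H' := shiftedDegree k n D) ?_ (LinearMap.snd S S S)
      (fun d m hm => hm.2) (fun d f hf => ⟨(0, f), ⟨AddSubgroup.zero_mem _, hf⟩, rfl⟩) ?_
      (isLinearUpTo_shiftedDegree _ _)
    · exact fun e d f hf m hm => ⟨isGradedSMul_monomialDegree A c e d f hf _ hm.1,
        mul_mem_shiftedDegree hf hm.2⟩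
    · refine hA.map (LinearMap.inl S S S)
        (fun d m hm => ⟨⟨hm, AddSubgroup.zero_mem _⟩, rfl⟩) (fun d m hm => ?_)
        (fun d m _ h => congrArg Prod.fst h)
      have h2 : m.2 = 0 := hm.2
      exact ⟨m.1, hm.1.1, Prod.ext rfl h2.symm⟩
  refine IsLinearUpTo.quotient (H := H) ((LinearMap.id : S →ₗ[S] S).coprod mulA)
    (fun d m hm => AddSubgroup.add_mem _ (hA' d hm.1) (hmulA_mem d _ hm.2))
    (fun d f hf => ?_) ?_ hHlin
  · refine ⟨(modMonomial f a, divMonomial f a), ⟨fun m hm => ?_, fun m hm => ?_⟩, ?_⟩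
    · by_cases hle : a ≤ m
      · exact absurd (coeff_modMonomial_of_le f hle) hm
      · rw [coeff_modMonomial_of_not_le f hle] at hm
        obtain ⟨h, x, hx, hxm⟩ := hf m hm
        refine ⟨h, x, hx.resolve_left ?_, hxm⟩
        rintro rfl
        exact hle hxm
    · rw [coeff_divMonomial] at hm
      have := (hf _ hm).1
      rw [map_add] at this
      omega
    · exact modMonomial_add_divMonomial f a
  · refine hB.map ((-mulA).prod LinearMap.id) (fun d f hf => ?_) (fun d m hm => ?_)
      (fun d f _ h => congrArg Prod.snd h)
    · have hf' : f ∈ shiftedDegree k n D d := fun m hm => (hf m hm).1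
      refine ⟨⟨AddSubgroup.neg_mem _ ((hmulA_iff d f hf').2 hf), hf'⟩, ?_⟩
      change -mulA f + mulA f = 0
      exact neg_add_cancel _
    · have h0 : m.1 + mulA m.2 = 0 := hm.2
      have h1 : -mulA m.2 = m.1 := (eq_neg_of_add_eq_zero_left h0).symm
      refine ⟨m.2, (hmulA_iff d _ hm.1.2).1 ?_, Prod.ext h1 rfl⟩
      rw [← neg_neg (mulA m.2), h1]
      exact AddSubgroup.neg_mem _ hm.1.1

theorem isLinearUpTo_variables (U : Finset (Fin n)) (p c : ℕ) :
    IsLinearUpTo (k := k) (n := n) p (c + 1)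
      (monomialDegree k ((fun i => Finsupp.single i 1) '' (U : Set (Fin n))) c) := by
  induction U using Finset.induction_on generalizing p c with
  | empty =>
    refine isLinearUpTo_of_eq_zero (fun d f hf => ?_) _ _
    ext a
    by_contra hne
    simpa using (hf a (by simpa using hne)).2
  | insert x U hx ih =>
    have key : ∀ p, IsLinearUpTo (k := k) (n := n) (p + 1) (c + 1) (monomialDegree k
        ((fun i => Finsupp.single i 1) '' ((insert x U : Finset (Fin n)) : Set (Fin n))) c) := by
      intro p
      rw [Finset.coe_insert, Set.image_insert_eq]
      refine (ih (p + 1) c).insert_monomial (ih p (c + 1)) ?_ fun m => ?_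
      · rw [Finsupp.degree_single, add_comm]
      · simp only [Set.exists_mem_image, Finsupp.single_le_iff]
        refine exists_congr fun i => and_congr_right fun hi => ?_
        have : i ≠ x := fun h => hx (h ▸ hi)
        simp [this.symm]
    cases p with
    | zero => exact fun d hd m hm => (key 0).eq_zero_of_lt hd hm
    | succ p => exact key p

/-- A monomial ideal with linear quotients, generated in one degree, has a linear resolution. -/
theorem isLinearUpTo_of_linearQuotients {τ α : Type*} [LinearOrder α] (Ω : Finset τ)
    (key : τ → α) (hkey : Function.Injective key) (E : τ → Fin n →₀ ℕ) (D : ℕ)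
    (hE : ∀ a ∈ Ω, (E a).degree = D) (U : τ → Finset (Fin n))
    (hcolon : ∀ a ∈ Ω, ∀ m : Fin n →₀ ℕ,
      (∃ i ∈ U a, m i ≠ 0) ↔ ∃ b ∈ Ω, key b < key a ∧ E b ≤ m + E a) (p : ℕ) :
    IsLinearUpTo (k := k) (n := n) p D (monomialDegree k (E '' (Ω : Set τ)) 0) := by
  classical
  suffices h : ∀ s ⊆ Ω, (∀ x ∈ s, ∀ y ∈ Ω, key y < key x → y ∈ s) → ∀ p,
      IsLinearUpTo (k := k) (n := n) p D (monomialDegree k (E '' (s : Set τ)) 0) from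
    h Ω subset_rfl (fun _ _ y hy _ => hy) p
  intro s
  induction s using Finset.induction_on_max_value key with
  | empty =>
    refine fun _ _ p => isLinearUpTo_of_eq_zero (fun d f hf => ?_) _ _
    ext a
    by_contra hne
    simpa using (hf a (by simpa using hne)).2
  | insert a s has hmax ih =>
    intro hs hlow
    have hlt : ∀ x ∈ s, key x < key a := fun x hx =>
      lt_of_le_of_ne (hmax x hx) fun h => has (hkey h ▸ hx)
    have haΩ : a ∈ Ω := hs (Finset.mem_insert_self a s)
    have ih' := ih (fun x hx => hs (Finset.mem_insert_of_mem hx)) fun x hx y hy hyx =>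
      Finset.mem_of_mem_insert_of_ne (hlow x (Finset.mem_insert_of_mem hx) y hy hyx)
        (by rintro rfl; exact (hyx.trans (hlt x hx)).false)
    have main : ∀ p, IsLinearUpTo (k := k) (n := n) (p + 1) D
        (monomialDegree k (E '' ((insert a s : Finset τ) : Set τ)) 0) := by
      intro p
      rw [Finset.coe_insert, Set.image_insert_eq]
      refine (ih' (p + 1)).insert_monomial (isLinearUpTo_variables (U a) p D) (hE a haΩ)
        fun m => ?_
      simp only [Set.exists_mem_image, Finsupp.single_le_iff, Finset.mem_coe,
        Nat.one_le_iff_ne_zero]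
      rw [hcolon a haΩ m]
      constructor
      · rintro ⟨b, hb, hlt', hle⟩
        exact ⟨b, Finset.mem_of_mem_insert_of_ne
          (hlow a (Finset.mem_insert_self a s) b hb hlt') (by rintro rfl; exact hlt'.false), hle⟩
      · rintro ⟨b, hb, hle⟩
        exact ⟨b, hs (Finset.mem_insert_of_mem hb), hlt b hb, hle⟩
    intro p
    cases p with
    | zero => exact fun d hd m hm => (main 0).eq_zero_of_lt hd hm
    | succ p => exact main p

end LinearResolutions

section RootedTrees

variable {n : ℕ}

/-- A leaf `r` of a tree chosen as root, with its neighbour `c`, the parent of every vertex other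
than `r`, and a depth function. -/
structure LeafRooting (G : SimpleGraph (Fin n)) where
  (r c : Fin n)
  (par : Fin n → Fin n)
  (depth : Fin n → ℕ)
  depth_par_lt : ∀ v, v ≠ r → depth (par v) < depth v
  par_ne_root : ∀ v, v ≠ r → v ≠ c → par v ≠ r
  depth_lt : ∀ v, v ≠ r → v ≠ c → depth c < depth v
  mem_edgeSet : ∀ e, e ∈ G.edgeSet ↔ ∃ v, v ≠ r ∧ e = s(v, par v)

theorem SimpleGraph.IsTree.nonempty_leafRooting {G : SimpleGraph (Fin n)} (hG : G.IsTree)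
    (hn : 2 ≤ n) : Nonempty (LeafRooting G) := by
  classical
  have : Nontrivial (Fin n) := Fin.nontrivial_iff_two_le.2 hn
  obtain ⟨r, hr⟩ := hG.exists_vert_degree_one_of_nontrivial
  obtain ⟨c, hrc, hc⟩ := SimpleGraph.degree_eq_one_iff_existsUnique_adj.1 hr
  have hpar : ∀ v, ∃ w, v ≠ r → G.Adj v w ∧ G.dist r v = G.dist r w + 1 := by
    intro v
    by_cases hv : v = r
    · exact ⟨v, fun h => absurd hv h⟩
    obtain ⟨p, hp⟩ := hG.connected.exists_walk_length_eq_dist v r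
    cases p with
    | nil => exact absurd rfl hv
    | @cons _ w _ h q =>
      refine ⟨w, fun _ => ⟨h, ?_⟩⟩
      have h1 := SimpleGraph.dist_le q
      rw [SimpleGraph.Walk.length_cons] at hp
      have h2 := hG.dist_eq_dist_add_one_of_adj r h
      rw [SimpleGraph.dist_comm (u := r) (v := v), SimpleGraph.dist_comm (u := r) (v := w)] at *
      omega
  choose par hpar using hpar
  have hne : ∀ v, v ≠ r → v ≠ c → par v ≠ r := by
    intro v hv hvc h
    exact hvc (hc v (h ▸ (hpar v hv).1.symm))
  refine ⟨⟨r, c, par, G.dist r, fun v hv => ?_, hne, fun v hv hvc => ?_, ?_⟩⟩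
  · have := (hpar v hv).2
    omega
  · have h1 := (hpar v hv).2
    have h2 := hG.connected.pos_dist_of_ne (hne v hv hvc).symm
    have h3 : G.dist r c = 1 := SimpleGraph.dist_eq_one_iff_adj.2 hrc
    omega
  · have hsub : (Finset.univ.erase r).image (fun v => s(v, par v)) ⊆ G.edgeFinset := by
      intro e he
      obtain ⟨v, hv, rfl⟩ := Finset.mem_image.1 he
      exact SimpleGraph.mem_edgeFinset.2 (hpar v (Finset.ne_of_mem_erase hv)).1
    have hinj : Set.InjOn (fun v => s(v, par v)) (Finset.univ.erase r : Finset (Fin n)) := by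
      intro v hv w hw h
      have h1 := (hpar v (Finset.ne_of_mem_erase hv)).2
      have h2 := (hpar w (Finset.ne_of_mem_erase hw)).2
      rcases Sym2.eq_iff.1 h with h | ⟨h, h'⟩
      · exact h.1
      · rw [h'] at h1
        rw [← h] at h2
        omega
    have heq := Finset.eq_of_subset_of_card_le hsub (by
      rw [Finset.card_image_of_injOn hinj, Finset.card_erase_of_mem (Finset.mem_univ r),
        Finset.card_univ, ← hG.card_edgeFinset]
      simp)
    intro e
    rw [← SimpleGraph.mem_edgeFinset, ← heq]
    simp [eq_comm]

namespace LeafRooting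

variable {G : SimpleGraph (Fin n)} (T : LeafRooting G)

/-- The exponent of the generator belonging to the edge from `v` to its parent. -/
noncomputable def edgeExponent (v : Fin n) : Fin n →₀ ℕ :=
  Finsupp.equivFunOnFinite.symm fun i => if i = v ∨ i = T.par v then 0 else 1

theorem edgeExponent_apply (v i : Fin n) :
    T.edgeExponent v i = if i = v ∨ i = T.par v then 0 else 1 := rfl

/-- The exponent of a product of generators. -/
noncomputable def exponent (a : Fin n → ℕ) : Fin n →₀ ℕ := ∑ v, a v • T.edgeExponent v

theorem exponent_add (a b : Fin n → ℕ) : T.exponent (a + b) = T.exponent a + T.exponent b := by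
  simp [exponent, add_smul, Finset.sum_add_distrib]

theorem exponent_single (v : Fin n) : T.exponent (Pi.single v 1) = T.edgeExponent v := by
  classical
  rw [exponent, Finset.sum_eq_single v]
  · simp
  · intro w _ hw
    simp [hw]
  · simp

/-- The products of `s` generators. -/
def words (s : ℕ) : Finset (Fin n → ℕ) :=
  (Finset.piAntidiag Finset.univ s).filter fun a => a T.r = 0

theorem mem_words {s : ℕ} {a : Fin n → ℕ} : a ∈ T.words s ↔ ∑ v, a v = s ∧ a T.r = 0 := by
  simp [words]

theorem par_ne (v : Fin n) (hv : v ≠ T.r) : T.par v ≠ v := fun h => by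
  have := T.depth_par_lt v hv
  rw [h] at this
  exact this.false

theorem degree_edgeExponent (v : Fin n) (hv : v ≠ T.r) : (T.edgeExponent v).degree = n - 2 := by
  have h : (T.edgeExponent v).degree = ∑ i, T.edgeExponent v i := Finsupp.degree_eq_sum _
  rw [h]
  simp only [edgeExponent_apply]
  have h2 := Finset.card_compl ({v, T.par v} : Finset (Fin n))
  rw [Finset.card_pair (T.par_ne v hv).symm, Fintype.card_fin] at h2
  rw [← h2, Finset.card_eq_sum_ones, ← Finset.sum_filter_add_sum_filter_not Finset.univ
    (fun i => i = v ∨ i = T.par v), Finset.sum_eq_zero, zero_add]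
  · refine Finset.sum_congr ?_ ?_
    · ext i
      simp
    · intro i hi
      rw [if_neg]
      simpa using hi
  · intro i hi
    rw [if_pos (Finset.mem_filter.1 hi).2]

theorem degree_exponent {s : ℕ} {a : Fin n → ℕ} (ha : a ∈ T.words s) :
    (T.exponent a).degree = s * (n - 2) := by
  obtain ⟨h1, h2⟩ := T.mem_words.1 ha
  rw [exponent, map_sum, ← h1, Finset.sum_mul]
  refine Finset.sum_congr rfl fun v _ => ?_
  rw [map_nsmul, smul_eq_mul]
  by_cases hv : v = T.r
  · simp [hv, h2]
  · rw [T.degree_edgeExponent v hv]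

theorem exponent_apply_add {s : ℕ} {a : Fin n → ℕ} (ha : a ∈ T.words s) (i : Fin n) :
    T.exponent a i + ∑ v, (if i = v ∨ i = T.par v then a v else 0) = s := by
  rw [exponent, Finsupp.finsetSum_apply, ← Finset.sum_add_distrib, ← (T.mem_words.1 ha).1]
  refine Finset.sum_congr rfl fun v _ => ?_
  rw [Finsupp.smul_apply, edgeExponent_apply]
  split_ifs <;> simp

/-- The vertices sorted by decreasing depth. -/
noncomputable def sorted : Equiv.Perm (Fin n) :=
  Tuple.sort fun v => OrderDual.toDual (T.depth v)

theorem sorted_symm_lt {v w : Fin n} (h : T.depth v < T.depth w) :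
    T.sorted.symm w < T.sorted.symm v := by
  by_contra hle
  have := Tuple.monotone_sort (fun v => OrderDual.toDual (T.depth v)) (not_lt.1 hle)
  change OrderDual.toDual (T.depth (T.sorted _)) ≤ OrderDual.toDual (T.depth (T.sorted _)) at this
  rw [Equiv.apply_symm_apply, Equiv.apply_symm_apply, OrderDual.toDual_le_toDual] at this
  omega

/-- The lexicographic order on products of generators, the deepest edges being the largest. -/
noncomputable def key (a : Fin n → ℕ) : Lex (Fin n → ℕ) := toLex (a ∘ T.sorted)

theorem key_injective : Function.Injective T.key := by
  intro a b h
  have h' : a ∘ T.sorted = b ∘ T.sorted := toLex.injective h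
  exact T.sorted.surjective.injective_comp_right h'

theorem key_lt_key {a b : Fin n → ℕ} : T.key b < T.key a ↔
    ∃ v, (∀ w, T.sorted.symm w < T.sorted.symm v → b w = a w) ∧ b v < a v := by
  constructor
  · rintro ⟨i, h, hi⟩
    refine ⟨T.sorted i, fun w hw => ?_, hi⟩
    rw [Equiv.symm_apply_apply] at hw
    have : b (T.sorted (T.sorted.symm w)) = a (T.sorted (T.sorted.symm w)) := h _ hw
    rwa [Equiv.apply_symm_apply] at this
  · rintro ⟨v, h, hv⟩
    refine ⟨T.sorted.symm v, fun j hj => h (T.sorted j) (by rwa [Equiv.symm_apply_apply]), ?_⟩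
    change b (T.sorted _) < a (T.sorted _)
    rwa [Equiv.apply_symm_apply]

theorem colon {s : ℕ} {a : Fin n → ℕ} (ha : a ∈ T.words s) (m : Fin n →₀ ℕ) :
    (∃ i ∈ Finset.univ.filter (fun i => a i ≠ 0 ∧ i ≠ T.c), m i ≠ 0) ↔
      ∃ b ∈ T.words s, T.key b < T.key a ∧ T.exponent b ≤ m + T.exponent a := by
  have ha' := T.mem_words.1 ha
  constructor
  · rintro ⟨i, hi, hm⟩
    obtain ⟨hai, hic⟩ := (Finset.mem_filter.1 hi).2
    have hir : i ≠ T.r := by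
      rintro rfl
      exact hai ha'.2
    obtain ⟨a', rfl⟩ : ∃ a', a = a' + Pi.single i 1 := by
      refine ⟨a - Pi.single i 1, (tsub_add_cancel_of_le ?_).symm⟩
      intro j
      rcases eq_or_ne j i with rfl | h
      · simpa [Nat.one_le_iff_ne_zero] using hai
      · simp [h]
    have hpi := T.par_ne i hir
    refine ⟨a' + Pi.single (T.par i) 1, T.mem_words.2 ⟨?_, ?_⟩, T.key_lt_key.2 ⟨i, ?_, ?_⟩, ?_⟩
    · rw [← ha'.1]
      simp [Finset.sum_add_distrib]
    · have := ha'.2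
      simp only [Pi.add_apply, Nat.add_eq_zero_iff] at this ⊢
      exact ⟨this.1, by simp [(T.par_ne_root i hir hic).symm]⟩
    · intro w hw
      have h1 : w ≠ i := by
        rintro rfl
        exact hw.false
      have h2 : w ≠ T.par i := by
        rintro rfl
        exact hw.asymm (T.sorted_symm_lt (T.depth_par_lt i hir))
      simp [h1, h2]
    · simp [hpi.symm]
    · rw [exponent_add, exponent_add, exponent_single, exponent_single]
      intro j
      simp only [Finsupp.add_apply, edgeExponent_apply]
      rcases eq_or_ne j i with rfl | h
      · have := Nat.pos_of_ne_zero hm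
        split_ifs <;> omega
      · simp only [h, false_or]
        split_ifs <;> omega
  · rintro ⟨b, hb, hlt, hle⟩
    have hb' := T.mem_words.1 hb
    obtain ⟨v, heq, hv⟩ := T.key_lt_key.1 hlt
    refine ⟨v, ?_, fun hm => ?_⟩
    · refine Finset.mem_filter.2 ⟨Finset.mem_univ v, by omega, ?_⟩
      rintro rfl
      have : ∑ w, b w < ∑ w, a w := by
        refine Finset.sum_lt_sum (fun w _ => ?_) ⟨T.c, Finset.mem_univ _, hv⟩
        by_cases hr : w = T.r
        · rw [hr, hb'.2]
          exact Nat.zero_le _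
        by_cases hc : w = T.c
        · rw [hc]
          exact hv.le
        · exact (heq w (T.sorted_symm_lt (T.depth_lt w hr hc))).le
      omega
    · have h1 := T.exponent_apply_add ha v
      have h2 := T.exponent_apply_add hb v
      have h3 : T.exponent b v ≤ T.exponent a v := by simpa [hm] using hle v
      have : ∑ w, (if v = w ∨ v = T.par w then b w else 0) <
          ∑ w, (if v = w ∨ v = T.par w then a w else 0) := by
        refine Finset.sum_lt_sum (fun w _ => ?_) ⟨v, Finset.mem_univ v, by simpa using hv⟩
        split_ifs with h
        · by_cases hr : w = T.r
          · rw [hr, hb'.2]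
            exact Nat.zero_le _
          rcases h with rfl | h
          · exact hv.le
          · refine (heq w (T.sorted_symm_lt ?_)).le
            rw [h]
            exact T.depth_par_lt w hr
        · exact le_rfl
      omega

variable {k : Type*} [Field k]

open scoped Classical in
theorem prod_eq_monomial (v : Fin n) :
    ∏ i ∈ Finset.univ.filter (fun i : Fin n => i ∉ s(v, T.par v)), (X i : MvPolynomial (Fin n) k) =
      monomial (T.edgeExponent v) 1 := by
  rw [monomial_eq, C_1, one_mul, Finsupp.prod_fintype _ _ (fun i => pow_zero _),
    Finset.prod_filter]
  refine Finset.prod_congr rfl fun i _ => ?_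
  rw [edgeExponent_apply]
  by_cases h : i = v ∨ i = T.par v <;> simp [h]

open scoped Classical in
theorem span_pow_eq (s : ℕ) :
    (Ideal.span {f : MvPolynomial (Fin n) k | ∃ e ∈ G.edgeSet,
        f = ∏ i ∈ Finset.univ.filter (fun i : Fin n => i ∉ e), X i}) ^ s =
      Ideal.span ((fun m => monomial m (1 : k)) '' (T.exponent '' (T.words s : Set (Fin n → ℕ)))) := by
  have hgen : {f : MvPolynomial (Fin n) k | ∃ e ∈ G.edgeSet,
      f = ∏ i ∈ Finset.univ.filter (fun i : Fin n => i ∉ e), X i} =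
      {f | ∃ v, v ≠ T.r ∧ f = monomial (T.edgeExponent v) 1} := by
    ext f
    simp only [Set.mem_ofPred_eq, T.mem_edgeSet]
    constructor
    · rintro ⟨_, ⟨v, hv, rfl⟩, rfl⟩
      exact ⟨v, hv, T.prod_eq_monomial v⟩
    · rintro ⟨v, hv, rfl⟩
      exact ⟨_, ⟨v, hv, rfl⟩, (T.prod_eq_monomial v).symm⟩
  rw [hgen, Set.image_image]
  induction s with
  | zero =>
    rw [pow_zero, Ideal.one_eq_top, eq_comm, Ideal.eq_top_iff_one]
    refine Ideal.subset_span ⟨0, T.mem_words.2 (by simp), ?_⟩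
    simp [exponent]
  | succ s ih =>
    rw [pow_succ, ih, Ideal.span_mul_span']
    congr 1
    ext f
    simp only [Set.mem_mul, Set.mem_image, Finset.mem_coe, Set.mem_ofPred_eq]
    constructor
    · rintro ⟨_, ⟨a, ha, rfl⟩, _, ⟨v, hv, rfl⟩, rfl⟩
      obtain ⟨h1, h2⟩ := T.mem_words.1 ha
      refine ⟨a + Pi.single v 1, T.mem_words.2 ⟨?_, ?_⟩, ?_⟩
      · simp [Finset.sum_add_distrib, h1]
      · simp [h2, hv.symm]
      · rw [exponent_add, exponent_single, monomial_mul, one_mul]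
    · rintro ⟨a, ha, rfl⟩
      obtain ⟨h1, h2⟩ := T.mem_words.1 ha
      obtain ⟨v, -, hv⟩ := Finset.exists_ne_zero_of_sum_ne_zero (h1.trans_ne s.succ_ne_zero)
      obtain ⟨a', rfl⟩ : ∃ a', a = a' + Pi.single v 1 := by
        refine ⟨a - Pi.single v 1, (tsub_add_cancel_of_le ?_).symm⟩
        intro j
        rcases eq_or_ne j v with rfl | h
        · simpa [Nat.one_le_iff_ne_zero] using hv
        · simp [h]
      have hvr : v ≠ T.r := by
        rintro rfl
        exact hv h2
      refine ⟨_, ⟨a', T.mem_words.2 ⟨?_, ?_⟩, rfl⟩, _, ⟨v, hvr, rfl⟩, ?_⟩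
      · simpa [Finset.sum_add_distrib] using h1
      · exact (Nat.add_eq_zero_iff.1 h2).1
      · rw [exponent_add, exponent_single, monomial_mul, one_mul]

end LeafRooting

end RootedTrees

open scoped Classical in
/-- Let `J ⊆ k[X_1,…,X_n]` be the squarefree monomial ideal generated in degree
`n - 2` whose associated graph `G_J` is a tree (so `J` is generated by the
monomials `∏_{i ∉ e} X_i` over the `n - 1` edges `e` of a tree `G`).  Then
(the `x`-regularity of the Rees algebra of `J` is zero and consequently)
`J^s` has a linear resolution for every `s ≥ 1`: the graded Betti numbers of
`J^s` satisfy `β_{i,j}(J^s) = 0` whenever `j ≠ s(n-2) + i`. -/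
theorem powers_linear_resolution_of_tree
    {k : Type*} [Field k] (n : ℕ) (G : SimpleGraph (Fin n)) (hG : G.IsTree)
    (J : Ideal (MvPolynomial (Fin n) k))
    (hJ : J = Ideal.span {f | ∃ e ∈ G.edgeSet,
        f = ∏ i ∈ Finset.univ.filter (fun i : Fin n => i ∉ e), X i})
    (s : ℕ) (hs : 1 ≤ s) (β : ℕ → ℕ → ℕ)
    (hβ : IsMinimalGradedFreeResolution k n (fun _ => 1) β ↥(J ^ s)
      (fun dg => {f : ↥(J ^ s) | (f : MvPolynomial (Fin n) k) ∈
        weightedHomogeneousSubmodule k (fun _ => 1) dg})) :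
    ∀ i j, β i j ≠ 0 → j = s * (n - 2) + i := by
  have hlin : ∀ p, IsLinearUpTo (k := k) (n := n) p (s * (n - 2))
      fun d => shiftedDegree k n 0 d ⊓ Submodule.toAddSubgroup (J ^ s) := by
    intro p
    by_cases hn : 2 ≤ n
    · obtain ⟨T⟩ := hG.nonempty_leafRooting hn
      rw [hJ, T.span_pow_eq]
      simp only [← monomialDegree_eq]
      exact isLinearUpTo_of_linearQuotients (T.words s) T.key T.key_injective T.exponent _
        (fun a ha => T.degree_exponent ha) _ (fun a ha => T.colon ha) p
    · have hJ0 : J = ⊥ := by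
        rw [hJ, Ideal.span_eq_bot]
        rintro _ ⟨e, he, rfl⟩
        have : Subsingleton (Fin n) := Fin.subsingleton_iff_le_one.2 (by omega)
        induction e with
        | _ v w => exact absurd (Subsingleton.elim v w) (SimpleGraph.Adj.ne he)
      rw [hJ0]
      refine isLinearUpTo_of_eq_zero (fun d f hf => ?_) _ _
      have : f ∈ (⊥ : Ideal (MvPolynomial (Fin n) k)) ^ s := hf.2
      rwa [Ideal.bot_pow (by omega), Ideal.mem_bot] at this
  exact hβ.eq_of_isLinearUpTo hlin
end
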